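/- Let n ≥ 2, p < 1, and 0 < τ1 < τ2. Suppose f : S^{n-1} → ℝ satisfies τ1 < f(u) < τ2 for all u ∈ S^{n-1}, and K ∈ K_0^n is a solution of the L_p Minkowski problem dS_{K,p} = f dH^{n-1}. If the set X_0 = {x ∈ ∂K : N(K,x) ⊆ N(K,o)} satisfies H^{n-1}(X_0) = 0, then K is smooth. -/

import Mathlib

open MeasureTheory Set
open scoped ENNReal NNReal RealInnerProductSpace

noncomputable section

/-- Support function of a set `K`. -/
def suppFn {n : ℕ} (K : Set (EuclideanSpace ℝ (Fin n))) (u : EuclideanSpace ℝ (Fin n)) : ℝ :=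
  sSup ((fun y => ⟪u, y⟫) '' K)

/-- Face of `K` with outer normal `u`. -/
def face {n : ℕ} (K : Set (EuclideanSpace ℝ (Fin n))) (u : EuclideanSpace ℝ (Fin n)) :
    Set (EuclideanSpace ℝ (Fin n)) :=
  {z ∈ K | ⟪z, u⟫ = suppFn K u}

/-- Normal cone of `K` at `z`. -/
def normalCone {n : ℕ} (K : Set (EuclideanSpace ℝ (Fin n))) (z : EuclideanSpace ℝ (Fin n)) :
    Set (EuclideanSpace ℝ (Fin n)) :=
  {u | ∀ y ∈ K, ⟪u, y⟫ ≤ ⟪u, z⟫}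

/-- The unit sphere `S^{n-1}` in `ℝ^n`. -/
def unitSphere (n : ℕ) : Set (EuclideanSpace ℝ (Fin n)) :=
  Metric.sphere (0 : EuclideanSpace ℝ (Fin n)) 1

/-- Surface area measure of `K` evaluated on `ω`:
`S_K(ω) = H^{n-1}(⋃_{u ∈ ω} F(K,u))`. -/
def surfMeas {n : ℕ} (K : Set (EuclideanSpace ℝ (Fin n)))
    (ω : Set (EuclideanSpace ℝ (Fin n))) : ℝ≥0∞ :=
  μH[(n : ℝ) - 1] (⋃ u ∈ ω, face K u)

/-- `K ∈ 𝒦₀ⁿ`: compact convex with nonempty interior, containing the origin. -/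
def IsConvexBody0 {n : ℕ} (K : Set (EuclideanSpace ℝ (Fin n))) : Prop :=
  IsCompact K ∧ Convex ℝ K ∧ (interior K).Nonempty ∧ (0 : EuclideanSpace ℝ (Fin n)) ∈ K

/-- `K` is a solution of the `L_p` Minkowski problem `dS_{K,p} = f dH^{n-1}`. -/
def IsLpSolution {n : ℕ} (p : ℝ) (f : EuclideanSpace ℝ (Fin n) → ℝ)
    (K : Set (EuclideanSpace ℝ (Fin n))) : Prop :=
  μH[(n : ℝ) - 1] {u ∈ unitSphere n | suppFn K u = 0} = 0 ∧
  ∀ ω : Set (EuclideanSpace ℝ (Fin n)), MeasurableSet ω →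
    ω ⊆ {u ∈ unitSphere n | 0 < suppFn K u} →
    surfMeas K ω
      = ∫⁻ u in ω, ENNReal.ofReal ((n : ℝ) * f u * suppFn K u ^ (p - 1)) ∂μH[(n : ℝ) - 1]

/-- `x` is a smooth boundary point: the normal cone spans a one-dimensional space. -/
def IsSmoothPt {n : ℕ} (K : Set (EuclideanSpace ℝ (Fin n)))
    (x : EuclideanSpace ℝ (Fin n)) : Prop :=
  Module.finrank ℝ (Submodule.span ℝ (normalCone K x)) = 1

/-- `K` is smooth: every boundary point is a smooth point. -/
def IsSmoothBody {n : ℕ} (K : Set (EuclideanSpace ℝ (Fin n))) : Prop :=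
  ∀ x ∈ frontier K, IsSmoothPt K x

/-- Subgradient of `v` at `x` relative to the domain `Ω`. -/
def subgrad {n : ℕ} (Ω : Set (EuclideanSpace ℝ (Fin n))) (v : EuclideanSpace ℝ (Fin n) → ℝ)
    (x : EuclideanSpace ℝ (Fin n)) : Set (EuclideanSpace ℝ (Fin n)) :=
  {z | ∀ y ∈ Ω, v x + ⟪z, y - x⟫ ≤ v y}

/-- Monge–Ampère measure of `v` (relative to domain `Ω`) evaluated on `ω`. -/
def maMeasure {n : ℕ} (Ω : Set (EuclideanSpace ℝ (Fin n))) (v : EuclideanSpace ℝ (Fin n) → ℝ)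
    (ω : Set (EuclideanSpace ℝ (Fin n))) : ℝ≥0∞ :=
  μH[(n : ℝ)] (⋃ x ∈ ω, subgrad Ω v x)

/-- Hessian matrix of `v : ℝ^n → ℝ` at `x`. -/
def hessMatrix {n : ℕ} (v : EuclideanSpace ℝ (Fin n) → ℝ) (x : EuclideanSpace ℝ (Fin n)) :
    Matrix (Fin n) (Fin n) ℝ :=
  Matrix.of fun i j =>
    fderiv ℝ (fun y => fderiv ℝ v y (EuclideanSpace.single j 1)) x (EuclideanSpace.single i 1)


section supp
variable {n : ℕ} {K : Set (EuclideanSpace ℝ (Fin n))}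

lemma supp_bdd (hK : IsCompact K) (u : EuclideanSpace ℝ (Fin n)) :
    BddAbove ((fun y => ⟪u, y⟫) '' K) :=
  (hK.image (by fun_prop)).bddAbove

lemma le_supp (hK : IsCompact K) (u : EuclideanSpace ℝ (Fin n)) {y} (hy : y ∈ K) :
    ⟪u, y⟫ ≤ suppFn K u :=
  le_csSup (supp_bdd hK u) ⟨y, hy, rfl⟩

lemma supp_le (hne : K.Nonempty) (u : EuclideanSpace ℝ (Fin n)) {c : ℝ}
    (h : ∀ y ∈ K, ⟪u, y⟫ ≤ c) : suppFn K u ≤ c := by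
  apply csSup_le (hne.image _)
  rintro _ ⟨y, hy, rfl⟩
  exact h y hy

lemma supp_attain (hK : IsCompact K) (hne : K.Nonempty) (u : EuclideanSpace ℝ (Fin n)) :
    ∃ y ∈ K, ⟪u, y⟫ = suppFn K u := by
  obtain ⟨y, hy, h⟩ := hK.exists_isMaxOn (f := fun y => ⟪u, y⟫) hne (by fun_prop)
  exact ⟨y, hy, le_antisymm (le_supp hK u hy) (supp_le hne u fun z hz => h hz)⟩

lemma supp_smul (hK : IsCompact K) (hne : K.Nonempty) (u : EuclideanSpace ℝ (Fin n)) {t : ℝ}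
    (ht : 0 ≤ t) : suppFn K (t • u) = t * suppFn K u := by
  apply le_antisymm
  · apply supp_le hne
    intro y hy
    rw [real_inner_smul_left]
    exact mul_le_mul_of_nonneg_left (le_supp hK u hy) ht
  · obtain ⟨y, hy, h⟩ := supp_attain hK hne u
    rw [← h, ← real_inner_smul_left]
    exact le_supp hK _ hy

lemma supp_add (hK : IsCompact K) (hne : K.Nonempty) (u v : EuclideanSpace ℝ (Fin n)) :
    suppFn K (u + v) ≤ suppFn K u + suppFn K v := by
  apply supp_le hne
  intro y hy
  rw [inner_add_left]
  exact add_le_add (le_supp hK u hy) (le_supp hK v hy)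

lemma supp_convex (hK : IsCompact K) (hne : K.Nonempty) : ConvexOn ℝ univ (suppFn K) := by
  refine ⟨convex_univ, fun u _ v _ a b ha hb _ => ?_⟩
  have := supp_add hK hne (a • u) (b • v)
  rwa [supp_smul hK hne _ ha, supp_smul hK hne _ hb] at this

lemma supp_continuous (hK : IsCompact K) (hne : K.Nonempty) : Continuous (suppFn K) := by
  have := (supp_convex hK hne).continuousOn isOpen_univ
  rwa [continuousOn_univ] at this

lemma mem_face_iff (hK : IsCompact K) (u z : EuclideanSpace ℝ (Fin n)) :
    z ∈ face K u ↔ z ∈ K ∧ u ∈ normalCone K z := by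
  constructor
  · rintro ⟨hz, h⟩
    refine ⟨hz, fun y hy => ?_⟩
    rw [real_inner_comm z u, h]
    exact le_supp hK u hy
  · rintro ⟨hz, h⟩
    refine ⟨hz, ?_⟩
    rw [real_inner_comm]
    exact le_antisymm (le_supp hK u hz) (supp_le ⟨z, hz⟩ u h)

lemma face_smul (hK : IsCompact K) (u : EuclideanSpace ℝ (Fin n)) {t : ℝ} (ht : 0 < t) :
    face K (t • u) = face K u := by
  ext z
  rw [mem_face_iff hK, mem_face_iff hK]
  refine and_congr_right fun _ => ?_
  simp only [normalCone, mem_ofPred_eq, real_inner_smul_left]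
  exact forall₂_congr fun y _ => mul_le_mul_iff_right₀ ht

end supp

section polar
variable {F : Type*} [NormedAddCommGroup F] [InnerProductSpace ℝ F]

/-- Polar set of `T - z`. -/
def polarAt (T : Set F) (z : F) : Set F := {s | ∀ w ∈ T, ⟪s, w - z⟫ ≤ 1}

lemma polarAt_convex (T : Set F) (z : F) : Convex ℝ (polarAt T z) := by
  intro s hs t ht a b ha hb hab w hw
  rw [inner_add_left, real_inner_smul_left, real_inner_smul_left]
  have h1 := hs w hw
  have h2 := ht w hw
  nlinarith

lemma polarAt_closed (T : Set F) (z : F) : IsClosed (polarAt T z) := by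
  have : polarAt T z = ⋂ w ∈ T, {s | ⟪s, w - z⟫ ≤ 1} := by
    ext; simp [polarAt]
  rw [this]
  exact isClosed_biInter fun w _ => isClosed_le (by fun_prop) (by fun_prop)

variable [FiniteDimensional ℝ F] [MeasurableSpace F] [BorelSpace F]

lemma polarAt_meas_pos (μ : Measure F) [μ.IsAddHaarMeasure] (T : Set F) (z : F) {R : ℝ}
    (hT : ∀ w ∈ T, ‖w - z‖ ≤ R) : 0 < μ (polarAt T z) := by
  have h0 : (0:ℝ) < (|R| + 1)⁻¹ := by positivity
  refine lt_of_lt_of_le (Metric.measure_ball_pos μ (0:F) h0) (measure_mono ?_)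
  intro s hs w hw
  rw [mem_ball_zero_iff] at hs
  have h1 := real_inner_le_norm s (w - z)
  have h2 := hT w hw
  have h3 := le_abs_self R
  calc ⟪s, w - z⟫ ≤ ‖s‖ * ‖w - z‖ := h1
    _ ≤ (|R| + 1)⁻¹ * (|R| + 1) := by gcongr; linarith
    _ = 1 := inv_mul_cancel₀ (by positivity)

lemma polarAt_meas_lt_top (μ : Measure F) [μ.IsAddHaarMeasure] (T : Set F) (z : F)
    (hT : z ∈ interior T) : μ (polarAt T z) < ⊤ := by
  obtain ⟨r, hr, hb⟩ := Metric.isOpen_iff.1 isOpen_interior z hT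
  refine lt_of_le_of_lt (measure_mono ?_) (measure_closedBall_lt_top (x := (0:F)) (r := 2 / r) (μ := μ))
  intro s hs
  rw [mem_closedBall_zero_iff]
  by_cases h0 : s = 0
  · subst h0; simp; positivity
  have hs0 : 0 < ‖s‖ := norm_pos_iff.2 h0
  have hw : z + (r / 2 / ‖s‖) • s ∈ T := by
    apply interior_subset
    apply hb
    rw [mem_ball_iff_norm, add_sub_cancel_left, norm_smul, Real.norm_of_nonneg (by positivity)]
    field_simp
    linarith
  have := hs _ hw
  rw [add_sub_cancel_left, real_inner_smul_right, real_inner_self_eq_norm_sq] at this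
  rw [le_div_iff₀ hr]
  field_simp at this
  linarith

open scoped Pointwise in
lemma polar_blowup (μ : Measure F) [μ.IsAddHaarMeasure] (T : Set F) (u0 u2 z1 a : F)
    (hz : u0 - z1 = z1 - u2) (h0 : u0 ∈ T) (h2 : u2 ∈ T) (ha : ⟪a, u0 - z1⟫ = 1) (N : ℕ) {δ : ℝ}
    (hδ : 0 < δ) (hNδ : 2 * N * δ < 1) (hT : ∀ w ∈ T, ⟪a, w⟫ ≤ ⟪a, u0⟫ + δ) :
    (N : ℝ≥0∞) * (ENNReal.ofReal ((1/4 : ℝ) ^ Module.finrank ℝ F) * μ (polarAt T z1)) ≤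
      μ (polarAt T u0) := by
  rcases Nat.eq_zero_or_pos N with rfl | hN
  · simp
  have hN' : (0:ℝ) < N := by exact_mod_cast hN
  set c : ℕ → ℝ := fun i => (1 - i / (2 * N)) / 2 with hc
  set b : ℕ → F := fun i => ((i / (2 * N)) / δ : ℝ) • a with hb
  set Q : ℕ → Set F := fun i => (fun s => b i + s) '' (c i • polarAt T z1) with hQ
  have hlt : ∀ i ∈ Finset.range N, (i : ℝ) / (2 * N) ≤ 1 / 2 := by
    intro i hi
    have : (i:ℝ) ≤ N := by exact_mod_cast (Finset.mem_range.1 hi).le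
    rw [div_le_div_iff₀ (by positivity) (by norm_num)]
    linarith
  have hpe : ∀ s ∈ polarAt T z1, |⟪s, u0 - z1⟫| ≤ 1 := by
    intro s hs
    rw [abs_le]
    refine ⟨?_, hs u0 h0⟩
    have := hs u2 h2
    rw [← neg_sub, ← hz, inner_neg_right] at this
    linarith
  have hsub : ∀ i ∈ Finset.range N, Q i ⊆ polarAt T u0 := by
    rintro i hi _ ⟨_, ⟨s, hs, rfl⟩, rfl⟩ w hw
    have hi' := hlt i hi
    have h1 : ⟪s, w - u0⟫ ≤ 2 := by
      have e1 : w - u0 = (w - z1) - (u0 - z1) := by abel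
      rw [e1, inner_sub_right]
      have := hs w hw
      have := abs_le.1 (hpe s hs)
      linarith
    have h3 : ⟪a, w - u0⟫ ≤ δ := by
      rw [inner_sub_right]; linarith [hT w hw]
    simp only [hb, hc]
    rw [inner_add_left, real_inner_smul_left, real_inner_smul_left]
    have h4 : (i:ℝ) / (2 * N) / δ * ⟪a, w - u0⟫ ≤ (i:ℝ) / (2 * N) / δ * δ := by gcongr
    rw [div_mul_cancel₀ _ hδ.ne'] at h4
    have h5 : (1 - (i:ℝ) / (2 * N)) / 2 * ⟪s, w - u0⟫ ≤ (1 - (i:ℝ) / (2 * N)) / 2 * 2 :=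
      mul_le_mul_of_nonneg_left h1 (by linarith)
    linarith
  have hval : ∀ i ∈ Finset.range N, ∀ q ∈ Q i,
      |⟪q, u0 - z1⟫ - i / (2 * N) / δ| ≤ 1 / 2 := by
    rintro i hi _ ⟨_, ⟨s, hs, rfl⟩, rfl⟩
    have hi' := hlt i hi
    have hi0 : (0:ℝ) ≤ i / (2 * N) := by positivity
    simp only [hb, hc]
    rw [inner_add_left, real_inner_smul_left, real_inner_smul_left, ha, mul_one,
      add_sub_cancel_left, abs_mul, abs_of_nonneg (by linarith)]
    calc _ ≤ (1 - (i:ℝ) / (2 * N)) / 2 * 1 := mul_le_mul_of_nonneg_left (hpe s hs) (by linarith)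
      _ ≤ 1 / 2 := by linarith
  have hgap : 1 < 1 / (2 * N) / δ := by
    rw [div_div, lt_div_iff₀ (by positivity)]; linarith
  have hdisj : (↑(Finset.range N) : Set ℕ).PairwiseDisjoint Q := by
    have key : ∀ i ∈ Finset.range N, ∀ j ∈ Finset.range N, i < j → Disjoint (Q i) (Q j) := by
      intro i hi j hj hij
      rw [Set.disjoint_left]
      intro q hqi hqj
      have h1 := abs_le.1 (hval i hi q hqi)
      have h2 := abs_le.1 (hval j hj q hqj)
      have h3 : (i:ℝ) + 1 ≤ j := by exact_mod_cast hij
      have h4 : ((i:ℝ) + 1) / (2 * N) / δ ≤ j / (2 * N) / δ := by gcongr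
      have h5 : ((i:ℝ) + 1) / (2 * N) / δ = i / (2 * N) / δ + 1 / (2 * N) / δ := by ring
      linarith
    intro i hi j hj hij
    rcases lt_or_gt_of_ne hij with h | h
    · exact key i hi j hj h
    · exact (key j hj i hi h).symm
  have hcpos : ∀ i ∈ Finset.range N, 1 / 4 ≤ c i := by
    intro i hi
    have hi' := hlt i hi
    simp only [hc]; linarith
  have hmeasQ : ∀ i ∈ Finset.range N, MeasurableSet (Q i) := by
    intro i hi
    have h4 : c i ≠ 0 := by linarith [hcpos i hi]
    have : IsClosed (c i • polarAt T z1) := (polarAt_closed T z1).smul_of_ne_zero h4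
    exact ((Homeomorph.addLeft (b i)).isClosedMap _ this).measurableSet
  have hQm : ∀ i ∈ Finset.range N,
      ENNReal.ofReal ((1/4 : ℝ) ^ Module.finrank ℝ F) * μ (polarAt T z1) ≤ μ (Q i) := by
    intro i hi
    have h4 := hcpos i hi
    simp only [hQ]
    rw [image_add_left, measure_preimage_add, Measure.addHaar_smul_of_nonneg μ (by linarith)]
    gcongr
  calc _ = ∑ i ∈ Finset.range N,
        ENNReal.ofReal ((1/4 : ℝ) ^ Module.finrank ℝ F) * μ (polarAt T z1) := by simp
    _ ≤ ∑ i ∈ Finset.range N, μ (Q i) := Finset.sum_le_sum hQm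
    _ = μ (⋃ i ∈ Finset.range N, Q i) := (measure_biUnion_finset hdisj hmeasQ).symm
    _ ≤ μ (polarAt T u0) := measure_mono (by simpa using hsub)

end polar

section slice
variable {n : ℕ} {K : Set (EuclideanSpace ℝ (Fin n))}

/-- Orthogonal complement of `e`. -/
abbrev Fe (e : EuclideanSpace ℝ (Fin n)) : Submodule ℝ (EuclideanSpace ℝ (Fin n)) :=
  (Submodule.span ℝ {e})ᗮ

/-- Orthogonal projection to the complement of `e`. -/
abbrev Pe (e : EuclideanSpace ℝ (Fin n)) : EuclideanSpace ℝ (Fin n) →L[ℝ] Fe e :=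
  (Fe e).orthogonalProjectionOnto

variable {e : EuclideanSpace ℝ (Fin n)}

lemma inner_e_coe (w : Fe e) : ⟪e, (w : EuclideanSpace ℝ (Fin n))⟫ = 0 :=
  (Submodule.mem_orthogonal_singleton_iff_inner_right).1 w.2

lemma coe_inner_e (w : Fe e) : ⟪(w : EuclideanSpace ℝ (Fin n)), e⟫ = 0 := by
  rw [real_inner_comm]; exact inner_e_coe w

lemma Pe_coe (w : Fe e) : Pe e (w : EuclideanSpace ℝ (Fin n)) = w := by simp

lemma Pe_e : Pe e e = 0 := by
  simp [Pe, Fe]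

lemma decomp (he : ‖e‖ = 1) (q : EuclideanSpace ℝ (Fin n)) :
    q = ⟪e, q⟫ • e + (Pe e q : EuclideanSpace ℝ (Fin n)) := by
  have hm : q - ⟪e, q⟫ • e ∈ Fe e := by
    rw [Submodule.mem_orthogonal_singleton_iff_inner_right, inner_sub_right, real_inner_smul_right,
      real_inner_self_eq_norm_sq, he]
    ring
  have h : Pe e q = ⟨q - ⟪e, q⟫ • e, hm⟩ := by
    have h1 : q = ⟪e, q⟫ • e + ((⟨q - ⟪e, q⟫ • e, hm⟩ : Fe e) : EuclideanSpace ℝ (Fin n)) := by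
      simp
    have h2 := congrArg (Pe e) h1
    rw [map_add, map_smul, Pe_e, smul_zero, zero_add, Pe_coe] at h2
    exact h2
  rw [h]; simp

lemma inner_slice (w : Fe e) (q : EuclideanSpace ℝ (Fin n)) :
    ⟪e + (w : EuclideanSpace ℝ (Fin n)), q⟫ = ⟪e, q⟫ + ⟪w, Pe e q⟫ := by
  rw [inner_add_left]
  congr 1
  simp [Pe]

lemma inner_e_slice (he : ‖e‖ = 1) (w : Fe e) :
    ⟪e, e + (w : EuclideanSpace ℝ (Fin n))⟫ = 1 := by
  rw [inner_add_right, inner_e_coe, real_inner_self_eq_norm_sq, he]; norm_num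

lemma norm_slice_ge (he : ‖e‖ = 1) (w : Fe e) :
    1 ≤ ‖e + (w : EuclideanSpace ℝ (Fin n))‖ := by
  have := real_inner_le_norm e (e + (w : EuclideanSpace ℝ (Fin n)))
  rw [inner_e_slice he, he, one_mul] at this
  exact this

lemma face_subgrad (hK : IsCompact K) {w : Fe e} {q : EuclideanSpace ℝ (Fin n)}
    (hq : q ∈ face K (e + w)) (w' : Fe e) :
    suppFn K (e + w) + ⟪Pe e q, w' - w⟫ ≤ suppFn K (e + w') := by
  obtain ⟨hqK, h⟩ := hq
  have h1 := le_supp hK (e + w') hqK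
  rw [real_inner_comm, inner_slice] at h
  rw [inner_slice] at h1
  rw [inner_sub_right, real_inner_comm, real_inner_comm w]
  linarith

open scoped Pointwise in
lemma subgrad_face (hK : IsCompact K) (hc : Convex ℝ K) (hne : K.Nonempty) (he : ‖e‖ = 1)
    {w s : Fe e} (hs : ∀ w' : Fe e, suppFn K (e + w) + ⟪s, w' - w⟫ ≤ suppFn K (e + w')) :
    ∃ q ∈ face K (e + w), Pe e q = s := by
  set q : EuclideanSpace ℝ (Fin n) := (suppFn K (e + w) - ⟪s, w⟫) • e + s with hq
  have hPq : Pe e q = s := by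
    rw [hq, map_add, map_smul, Pe_e, Pe_coe]; simp
  have heq : ⟪e, q⟫ = suppFn K (e + w) - ⟪s, w⟫ := by
    rw [hq, inner_add_right, real_inner_smul_right, inner_e_coe, real_inner_self_eq_norm_sq, he]
    ring
  have hqw : ∀ w' : Fe e, ⟪e + (w' : EuclideanSpace ℝ (Fin n)), q⟫ ≤ suppFn K (e + w') := by
    intro w'
    rw [inner_slice, hPq, heq]
    have := hs w'
    rw [inner_sub_right, real_inner_comm] at this
    linarith
  have hpos : ∀ u : EuclideanSpace ℝ (Fin n), 0 < ⟪e, u⟫ → ⟪u, q⟫ ≤ suppFn K u := by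
    intro u hu
    have h1 : u = ⟪e, u⟫ • (e + ((⟪e, u⟫⁻¹ • Pe e u : Fe e) : EuclideanSpace ℝ (Fin n))) := by
      conv_lhs => rw [decomp he u]
      rw [smul_add, Submodule.coe_smul, smul_smul, mul_inv_cancel₀ hu.ne', one_smul]
    rw [h1, real_inner_smul_left, supp_smul hK hne _ hu.le]
    exact mul_le_mul_of_nonneg_left (hqw _) hu.le
  have hnn : ∀ u : EuclideanSpace ℝ (Fin n), 0 ≤ ⟪e, u⟫ → ⟪u, q⟫ ≤ suppFn K u := by
    intro u hu
    have hcont : Continuous fun t : ℝ => suppFn K (u + t • e) - ⟪u + t • e, q⟫ :=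
      ((supp_continuous hK hne).comp (by fun_prop)).sub (by fun_prop)
    have hlim : Filter.Tendsto (fun t : ℝ => suppFn K (u + t • e) - ⟪u + t • e, q⟫)
        (nhdsWithin 0 (Ioi 0)) (nhds (suppFn K (u + (0:ℝ) • e) - ⟪u + (0:ℝ) • e, q⟫)) :=
      hcont.continuousWithinAt
    have := ge_of_tendsto hlim (b := 0) (by
      filter_upwards [self_mem_nhdsWithin] with t ht
      have := hpos (u + t • e) (by
        rw [inner_add_right, real_inner_smul_right, real_inner_self_eq_norm_sq, he]
        have : (0:ℝ) < t := ht
        linarith)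
      linarith)
    simp at this
    exact this
  set R : Set (EuclideanSpace ℝ (Fin n)) := (fun t : ℝ => t • e) '' Iic 0 with hR
  have he0 : e ≠ 0 := by rintro rfl; simp at he
  have hRc : IsClosed R := (isClosedEmbedding_smul_left he0).isClosedMap _ isClosed_Iic
  have hRconv : Convex ℝ R :=
    (convex_Iic (0:ℝ)).is_linear_image (f := fun t : ℝ => t • e) ⟨fun a b => add_smul a b e, fun a b => by simp [mul_smul]⟩
  have hmem : q ∈ K + R := by
    by_contra hnot
    obtain ⟨f, c, hfc, hcq⟩ := geometric_hahn_banach_closed_point (hc.add hRconv)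
      (hRc.add_left_of_isCompact hK) hnot
    set u := (InnerProductSpace.toDual ℝ _).symm f with hu
    have hfu : ∀ y, f y = ⟪u, y⟫ := fun y => by simp [hu]
    have h1 : ∀ y ∈ K, ∀ t : ℝ, t ≤ 0 → ⟪u, y⟫ + t * ⟪u, e⟫ < c := by
      intro y hy t ht
      have := hfc (y + t • e) (add_mem_add hy ⟨t, ht, rfl⟩)
      rwa [hfu, inner_add_right, real_inner_smul_right] at this
    have h2 : 0 ≤ ⟪e, u⟫ := by
      by_contra hneg
      push Not at hneg
      obtain ⟨y, hy⟩ := hne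
      rw [real_inner_comm] at hneg
      have h4 := h1 y hy 0 le_rfl
      have := h1 y hy ((c - ⟪u, y⟫) / ⟪u, e⟫) (div_nonpos_of_nonneg_of_nonpos (by linarith) hneg.le)
      rw [div_mul_cancel₀ _ hneg.ne] at this
      linarith
    have h3 : suppFn K u ≤ c := supp_le hne u fun y hy => by
      have := h1 y hy 0 le_rfl
      linarith
    have := hnn u h2
    rw [hfu] at hcq
    linarith
  obtain ⟨k, hk, _, ⟨t, ht, rfl⟩, hkt⟩ := hmem
  have ht' : t ≤ 0 := ht
  have hkt' : k + t • e = q := hkt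
  have h1 := le_supp hK (e + w) hk
  have hk' : k = q - t • e := by rw [← hkt']; simp
  have h2 : ⟪e + (w : EuclideanSpace ℝ (Fin n)), q⟫ = suppFn K (e + w) := by
    rw [inner_slice, hPq, heq, real_inner_comm]; ring
  have h3 : ⟪e + (w : EuclideanSpace ℝ (Fin n)), e⟫ = 1 := by
    rw [real_inner_comm, inner_e_slice he]
  rw [hk', inner_sub_right, h2, real_inner_smul_right, h3] at h1
  have ht0 : t = 0 := by linarith
  subst ht0
  have : k = q := by simpa using hk'
  rw [this] at hk
  exact ⟨q, ⟨hk, by rw [real_inner_comm]; exact h2⟩, hPq⟩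

lemma face_dist (hK : IsCompact K) (he : ‖e‖ = 1) {R : ℝ} {w w' : Fe e} (hw : ‖w‖ ≤ R)
    (hw' : ‖w'‖ ≤ R) {q q' : EuclideanSpace ℝ (Fin n)} (hq : q ∈ face K (e + w))
    (hq' : q' ∈ face K (e + w')) : dist q q' ≤ (1 + R) * dist (Pe e q) (Pe e q') := by
  have key : ∀ {w : Fe e} {q q' : EuclideanSpace ℝ (Fin n)}, ‖w‖ ≤ R → q ∈ face K (e + w) →
      q' ∈ K → ⟪e, q' - q⟫ ≤ R * ‖Pe e (q - q')‖ := by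
    intro w q q' hw hq hq'
    have h1 := ((mem_face_iff hK _ _).1 hq).2 q' hq'
    rw [inner_slice, inner_slice] at h1
    have h2 := real_inner_le_norm w (Pe e (q - q'))
    rw [map_sub, inner_sub_right] at h2
    rw [inner_sub_right, map_sub]
    have h3 : ‖w‖ * ‖Pe e q - Pe e q'‖ ≤ R * ‖Pe e q - Pe e q'‖ := by gcongr
    linarith
  have h1 := key hw hq hq'.1
  have h2 := key hw' hq' hq.1
  have h3 : |⟪e, q - q'⟫| ≤ R * ‖Pe e (q - q')‖ := by
    rw [abs_le]
    constructor
    · rw [← neg_sub q q', inner_neg_right] at h1; linarith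
    · rw [← neg_sub q q', map_neg, norm_neg] at h2; exact h2
  rw [dist_eq_norm, dist_eq_norm, ← map_sub]
  calc ‖q - q'‖ = ‖⟪e, q - q'⟫ • e + (Pe e (q - q') : EuclideanSpace ℝ (Fin n))‖ := by
        rw [← decomp he]
    _ ≤ ‖⟪e, q - q'⟫ • e‖ + ‖(Pe e (q - q') : EuclideanSpace ℝ (Fin n))‖ := norm_add_le _ _
    _ = |⟪e, q - q'⟫| + ‖Pe e (q - q')‖ := by rw [norm_smul, he, mul_one]; rfl
    _ ≤ _ := by linarith

lemma faces_meas_le (hK : IsCompact K) (he : ‖e‖ = 1) {R : ℝ} (hR : 0 ≤ R) {d : ℝ} (hd : 0 ≤ d)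
    (A : Set (Fe e)) (hA : ∀ w ∈ A, ‖w‖ ≤ R) :
    μH[d] (⋃ w ∈ A, face K (e + w)) ≤
      ENNReal.ofReal ((1 + R) ^ d) * μH[d] (Pe e '' (⋃ w ∈ A, face K (e + w))) := by
  set Q : Set (EuclideanSpace ℝ (Fin n)) := ⋃ w ∈ A, face K (e + w) with hQ
  have hdist : ∀ q ∈ Q, ∀ q' ∈ Q, dist q q' ≤ (1 + R) * dist (Pe e q) (Pe e q') := by
    intro q hq q' hq'
    simp only [hQ, mem_iUnion] at hq hq'
    obtain ⟨w, hw, hq⟩ := hq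
    obtain ⟨w', hw', hq'⟩ := hq'
    exact face_dist hK he (hA w hw) (hA w' hw') hq hq'
  have hinj : InjOn (Pe e) Q := by
    intro q hq q' hq' h
    have := hdist q hq q' hq'
    rw [h, dist_self, mul_zero] at this
    exact dist_le_zero.1 this
  set g := Function.invFunOn (Pe e) Q
  have hg : ∀ q ∈ Q, g (Pe e q) = q := fun q hq => hinj.leftInvOn_invFunOn hq
  have hlip : LipschitzOnWith (Real.toNNReal (1 + R)) g (Pe e '' Q) := by
    apply LipschitzOnWith.of_dist_le_mul
    rintro _ ⟨q, hq, rfl⟩ _ ⟨q', hq', rfl⟩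
    rw [hg q hq, hg q' hq', Real.coe_toNNReal _ (by linarith)]
    exact hdist q hq q' hq'
  have h1 := hlip.hausdorffMeasure_image_le hd
  have h2 : g '' (Pe e '' Q) = Q := by
    rw [image_image]
    conv_rhs => rw [← image_id Q]
    exact image_congr fun q hq => hg q hq
  rw [h2] at h1
  refine h1.trans (le_of_eq ?_)
  congr 1
  rw [← ENNReal.ofReal_rpow_of_nonneg (by linarith) hd]
  rfl

lemma proj_meas_le {d : ℝ} (hd : 0 ≤ d) (Q : Set (EuclideanSpace ℝ (Fin n))) :
    μH[d] (Pe e '' Q) ≤ μH[d] Q := by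
  have := (Submodule.lipschitzWith_orthogonalProjectionOnto (Fe e)).hausdorffMeasure_image_le hd Q
  simpa using this

end slice

section chart
variable {n : ℕ} {K : Set (EuclideanSpace ℝ (Fin n))}

/-- Gnomonic chart. -/
def gno (e u : EuclideanSpace ℝ (Fin n)) : Fe e := ⟪e, u⟫⁻¹ • Pe e u

/-- Inverse of the gnomonic chart. -/
def nu (e : EuclideanSpace ℝ (Fin n)) (w : Fe e) : EuclideanSpace ℝ (Fin n) :=
  ‖e + (w : EuclideanSpace ℝ (Fin n))‖⁻¹ • (e + (w : EuclideanSpace ℝ (Fin n)))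

variable {e : EuclideanSpace ℝ (Fin n)}

lemma slice_pos (he : ‖e‖ = 1) (w : Fe e) : 0 < ‖e + (w : EuclideanSpace ℝ (Fin n))‖ :=
  lt_of_lt_of_le one_pos (norm_slice_ge he w)

lemma nu_mem (he : ‖e‖ = 1) (w : Fe e) : nu e w ∈ unitSphere n := by
  have := slice_pos he w
  simp only [unitSphere, mem_sphere_iff_norm, sub_zero, nu]
  rw [norm_smul, norm_inv, norm_norm, inv_mul_cancel₀ this.ne']

lemma inner_nu (he : ‖e‖ = 1) (w : Fe e) :
    ⟪e, nu e w⟫ = ‖e + (w : EuclideanSpace ℝ (Fin n))‖⁻¹ := by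
  rw [nu, real_inner_smul_right, inner_e_slice he, mul_one]

lemma inner_nu_pos (he : ‖e‖ = 1) (w : Fe e) : 0 < ⟪e, nu e w⟫ := by
  rw [inner_nu he]; exact inv_pos.2 (slice_pos he w)

lemma gno_nu (he : ‖e‖ = 1) (w : Fe e) : gno e (nu e w) = w := by
  rw [gno, inner_nu he, nu, map_smul, map_add, Pe_e, Pe_coe, zero_add, smul_smul, inv_inv,
    mul_inv_cancel₀ (slice_pos he w).ne', one_smul]

lemma gno_smul (he : ‖e‖ = 1) {u : EuclideanSpace ℝ (Fin n)} (hu : 0 < ⟪e, u⟫) :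
    u = ⟪e, u⟫ • (e + (gno e u : EuclideanSpace ℝ (Fin n))) := by
  conv_lhs => rw [decomp he u]
  rw [smul_add, gno, Submodule.coe_smul, smul_smul, mul_inv_cancel₀ hu.ne', one_smul]

lemma inner_mul_norm (he : ‖e‖ = 1) {u : EuclideanSpace ℝ (Fin n)} (h1 : u ∈ unitSphere n)
    (hu : 0 < ⟪e, u⟫) : ⟪e, u⟫ * ‖e + (gno e u : EuclideanSpace ℝ (Fin n))‖ = 1 := by
  have h2 := congrArg norm (gno_smul he hu)
  rw [norm_smul, Real.norm_of_nonneg hu.le] at h2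
  rw [← h2]
  simpa [unitSphere] using h1

lemma nu_gno (he : ‖e‖ = 1) {u : EuclideanSpace ℝ (Fin n)} (h1 : u ∈ unitSphere n)
    (hu : 0 < ⟪e, u⟫) : nu e (gno e u) = u := by
  have h := inner_mul_norm he h1 hu
  rw [nu, ← eq_inv_of_mul_eq_one_left h]
  exact (gno_smul he hu).symm

lemma nu_lip (he : ‖e‖ = 1) (w w' : Fe e) : ‖nu e w - nu e w'‖ ≤ 2 * ‖w - w'‖ := by
  have ha := norm_slice_ge he w
  have hb := norm_slice_ge he w'
  set a := e + (w : EuclideanSpace ℝ (Fin n)) with hadef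
  set b := e + (w' : EuclideanSpace ℝ (Fin n)) with hbdef
  have hab : ‖a - b‖ = ‖w - w'‖ := by
    rw [hadef, hbdef, add_sub_add_left_eq_sub]; rfl
  have ha0 : 0 < ‖a‖ := by linarith
  have hb0 : 0 < ‖b‖ := by linarith
  have e1 : nu e w - nu e w' = ‖a‖⁻¹ • (a - b) + (‖a‖⁻¹ - ‖b‖⁻¹) • b := by
    simp only [nu]
    rw [smul_sub, sub_smul]
    abel
  have e2 : ‖(‖a‖⁻¹ - ‖b‖⁻¹) • b‖ ≤ ‖a‖⁻¹ * ‖a - b‖ := by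
    have : ‖a‖⁻¹ - ‖b‖⁻¹ = ‖a‖⁻¹ * ‖b‖⁻¹ * (‖b‖ - ‖a‖) := by field_simp
    rw [norm_smul, this, norm_mul, Real.norm_of_nonneg (by positivity)]
    have h3 : ‖(‖b‖ - ‖a‖ : ℝ)‖ ≤ ‖a - b‖ := by
      rw [norm_sub_rev]; exact abs_norm_sub_norm_le a b
    calc ‖a‖⁻¹ * ‖b‖⁻¹ * ‖(‖b‖ - ‖a‖ : ℝ)‖ * ‖b‖ = ‖a‖⁻¹ * ‖(‖b‖ - ‖a‖ : ℝ)‖ := by field_simp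
      _ ≤ _ := by gcongr
  have e3 : ‖a‖⁻¹ ≤ 1 := inv_le_one_of_one_le₀ ha
  calc ‖nu e w - nu e w'‖ ≤ ‖‖a‖⁻¹ • (a - b)‖ + ‖(‖a‖⁻¹ - ‖b‖⁻¹) • b‖ := by
        rw [e1]; exact norm_add_le _ _
    _ ≤ ‖a‖⁻¹ * ‖a - b‖ + ‖a‖⁻¹ * ‖a - b‖ := by
        gcongr
        rw [norm_smul, norm_inv, norm_norm]
    _ ≤ 1 * ‖a - b‖ + 1 * ‖a - b‖ := by gcongr
    _ = 2 * ‖w - w'‖ := by rw [hab]; ring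

lemma gno_lip (he : ‖e‖ = 1) {ρ : ℝ} (hρ : 0 < ρ) {u u' : EuclideanSpace ℝ (Fin n)}
    (hu' : u' ∈ unitSphere n) (h : ρ⁻¹ ≤ ⟪e, u⟫) (h' : ρ⁻¹ ≤ ⟪e, u'⟫) :
    ‖gno e u - gno e u'‖ ≤ (ρ + ρ ^ 2) * ‖u - u'‖ := by
  have hi : 0 < ρ⁻¹ := inv_pos.2 hρ
  set a := ⟪e, u⟫ with ha
  set b := ⟪e, u'⟫ with hb
  have ha0 : 0 < a := by linarith
  have hb0 : 0 < b := by linarith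
  have ha1 : a⁻¹ ≤ ρ := inv_le_of_inv_le₀ hρ h
  have hb1 : b⁻¹ ≤ ρ := inv_le_of_inv_le₀ hρ h'
  have e1 : gno e u - gno e u' = a⁻¹ • Pe e (u - u') + (a⁻¹ - b⁻¹) • Pe e u' := by
    simp only [gno, ← ha, ← hb]
    rw [map_sub, smul_sub, sub_smul]
    abel
  have hP : ∀ y, ‖Pe e y‖ ≤ ‖y‖ := fun y => Submodule.norm_orthogonalProjectionOnto_apply_le _ y
  have hu1 : ‖u'‖ = 1 := by simpa [unitSphere] using hu'
  have e2 : ‖(a⁻¹ - b⁻¹ : ℝ)‖ ≤ ρ ^ 2 * ‖u - u'‖ := by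
    have : a⁻¹ - b⁻¹ = a⁻¹ * b⁻¹ * (b - a) := by field_simp
    rw [this, norm_mul, Real.norm_of_nonneg (by positivity), pow_two]
    have h3 : ‖b - a‖ ≤ ‖u - u'‖ := by
      rw [norm_sub_rev, ha, hb, ← inner_sub_right]
      have := norm_inner_le_norm (𝕜 := ℝ) e (u - u')
      rwa [he, one_mul] at this
    gcongr
  calc ‖gno e u - gno e u'‖ ≤ ‖a⁻¹ • Pe e (u - u')‖ + ‖(a⁻¹ - b⁻¹) • Pe e u'‖ := by
        rw [e1]; exact norm_add_le _ _
    _ ≤ ρ * ‖u - u'‖ + ρ ^ 2 * ‖u - u'‖ * 1 := by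
        rw [norm_smul, norm_smul, Real.norm_of_nonneg (inv_pos.2 ha0).le]
        gcongr
        · exact hP _
        · rw [← hu1]; exact hP _
    _ = _ := by ring

lemma gno_measurable : Measurable (gno e) := by
  unfold gno
  exact ((by fun_prop : Continuous fun u => ⟪e, u⟫).measurable.inv).smul (Pe e).continuous.measurable

lemma nu_continuous (he : ‖e‖ = 1) : Continuous (nu e) := by
  unfold nu
  refine Continuous.smul (Continuous.inv₀ (by fun_prop) fun w => (slice_pos he w).ne') (by fun_prop)

/-- Spherical set corresponding to `A`. -/
def omg (K : Set (EuclideanSpace ℝ (Fin n))) (e : EuclideanSpace ℝ (Fin n)) (A : Set (Fe e)) :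
    Set (EuclideanSpace ℝ (Fin n)) :=
  {u | u ∈ unitSphere n ∧ 0 < ⟪e, u⟫ ∧ gno e u ∈ A ∧ 0 < suppFn K u}

lemma omg_measurable (hK : IsCompact K) (hne : K.Nonempty) {A : Set (Fe e)}
    (hA : MeasurableSet A) : MeasurableSet (omg K e A) := by
  have h1 : MeasurableSet {u : EuclideanSpace ℝ (Fin n) | 0 < ⟪e, u⟫} :=
    (isOpen_lt continuous_const (by fun_prop)).measurableSet
  have h2 : MeasurableSet {u : EuclideanSpace ℝ (Fin n) | 0 < suppFn K u} :=
    (isOpen_lt continuous_const (supp_continuous hK hne)).measurableSet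
  have h3 : MeasurableSet (unitSphere n) := Metric.isClosed_sphere.measurableSet
  exact h3.inter (h1.inter ((gno_measurable hA).inter h2))

lemma omg_faces (hK : IsCompact K) (hne : K.Nonempty) (he : ‖e‖ = 1) (A : Set (Fe e)) :
    (⋃ u ∈ omg K e A, face K u) = ⋃ w ∈ {w ∈ A | 0 < suppFn K (e + w)}, face K (e + w) := by
  ext q
  simp only [mem_iUnion, exists_prop]
  constructor
  · rintro ⟨u, ⟨h1, h2, h3, h4⟩, hq⟩
    rw [gno_smul he h2] at hq h4
    rw [face_smul hK _ h2] at hq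
    rw [supp_smul hK hne _ h2.le] at h4
    exact ⟨_, ⟨h3, pos_of_mul_pos_right h4 h2.le⟩, hq⟩
  · rintro ⟨w, ⟨hw, hpos⟩, hq⟩
    have h0 := inv_pos.2 (slice_pos he w)
    refine ⟨nu e w, ⟨nu_mem he w, inner_nu_pos he w, by rwa [gno_nu he], ?_⟩, ?_⟩
    · rw [nu, supp_smul hK hne _ h0.le]; positivity
    · rwa [nu, face_smul hK _ h0]

end chart

section doubling
variable {n : ℕ} {K : Set (EuclideanSpace ℝ (Fin n))} {e : EuclideanSpace ℝ (Fin n)}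

lemma supp_nonneg (hK : IsCompact K) (h0 : (0 : EuclideanSpace ℝ (Fin n)) ∈ K)
    (u : EuclideanSpace ℝ (Fin n)) : 0 ≤ suppFn K u := by
  have := le_supp hK u h0
  simpa using this

lemma norm_slice_le (he : ‖e‖ = 1) {R : ℝ} {w : Fe e} (hw : ‖w‖ ≤ R) :
    ‖e + (w : EuclideanSpace ℝ (Fin n))‖ ≤ 1 + R := by
  refine (norm_add_le _ _).trans ?_
  rw [he, Submodule.norm_coe]
  linarith

lemma doubling_meas (hK : IsCompact K) (h0 : (0 : EuclideanSpace ℝ (Fin n)) ∈ K) (he : ‖e‖ = 1)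
    (hn : 0 ≤ (n : ℝ) - 1)
    (hnull : μH[(n : ℝ) - 1] {u ∈ unitSphere n | suppFn K u = 0} = 0)
    {R : ℝ} (hR : 0 ≤ R) {z1 : Fe e} (hz : ‖z1‖ ≤ R) (A : Set (Fe e))
    (hA : ∀ w ∈ A, ‖w‖ ≤ R) (S : Set (EuclideanSpace ℝ (Fin n))) :
    μH[(n : ℝ) - 1] (omg K e A ∩ (fun u => nu e ((1/2 : ℝ) • (gno e u + z1))) ⁻¹' S) ≤
      ((Real.toNNReal (4 * ((1 + R) + (1 + R) ^ 2)) : ℝ≥0) : ℝ≥0∞) ^ ((n : ℝ) - 1) *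
        μH[(n : ℝ) - 1] (omg K e {w | (2 : ℝ) • w - z1 ∈ A} ∩ S) := by
  set d : ℝ := (n : ℝ) - 1 with hd
  set L := Real.toNNReal (4 * ((1 + R) + (1 + R) ^ 2)) with hL
  set ψ : EuclideanSpace ℝ (Fin n) → EuclideanSpace ℝ (Fin n) :=
    fun u => nu e ((1/2 : ℝ) • (gno e u + z1)) with hψ
  set χ : EuclideanSpace ℝ (Fin n) → EuclideanSpace ℝ (Fin n) :=
    fun u => nu e ((2 : ℝ) • gno e u - z1) with hχ
  set A' : Set (Fe e) := {w | (2 : ℝ) • w - z1 ∈ A} with hA'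
  set Ω : Set (EuclideanSpace ℝ (Fin n)) := {u | u ∈ unitSphere n ∧ 0 < ⟪e, u⟫ ∧ gno e u ∈ A'}
    with hΩ
  have hA'R : ∀ w ∈ A', ‖w‖ ≤ R := by
    intro w hw
    have h1 := hA _ hw
    have h2 : (2:ℝ) • w = ((2:ℝ) • w - z1) + z1 := by abel
    have h3 : ‖(2:ℝ) • w‖ ≤ R + R := by
      rw [h2]; exact (norm_add_le _ _).trans (add_le_add h1 hz)
    rw [norm_smul, Real.norm_of_nonneg (by norm_num)] at h3
    linarith
  have hΩe : ∀ u ∈ Ω, (1 + R)⁻¹ ≤ ⟪e, u⟫ := by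
    rintro u ⟨h1, h2, h3⟩
    have h4 := inner_mul_norm he h1 h2
    have h5 : ‖e + (gno e u : EuclideanSpace ℝ (Fin n))‖ ≤ 1 + R :=
      norm_slice_le he (hA'R _ h3)
    rw [inv_le_iff_one_le_mul₀ (by linarith)]
    exact h4.symm.le.trans (mul_le_mul_of_nonneg_left h5 h2.le)
  have hlip : LipschitzOnWith L χ Ω := by
    apply LipschitzOnWith.of_dist_le_mul
    intro u hu u' hu'
    rw [dist_eq_norm, dist_eq_norm, hL, Real.coe_toNNReal _ (by positivity)]
    have h1 := nu_lip he ((2 : ℝ) • gno e u - z1) ((2 : ℝ) • gno e u' - z1)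
    have h2 := gno_lip he (by linarith : 0 < 1 + R) hu'.1 (hΩe u hu) (hΩe u' hu')
    rw [sub_sub_sub_cancel_right, ← smul_sub, norm_smul, Real.norm_of_nonneg (by norm_num)] at h1
    simp only [hχ]
    linarith
  have hsub : omg K e A ∩ ψ ⁻¹' S ⊆ χ '' (Ω ∩ S) := by
    rintro u ⟨⟨h1, h2, h3, h4⟩, h5⟩
    have h6 : (2 : ℝ) • ((1/2 : ℝ) • (gno e u + z1)) - z1 = gno e u := by
      rw [smul_smul]; norm_num
    refine ⟨ψ u, ⟨⟨nu_mem he _, inner_nu_pos he _, ?_⟩, h5⟩, ?_⟩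
    · simp only [hψ, gno_nu he, hA', mem_ofPred_eq, h6]; exact h3
    · simp only [hχ, hψ, gno_nu he, h6]
      exact nu_gno he h1 h2
  have hsplit : Ω ∩ S ⊆ (omg K e A' ∩ S) ∪ {u ∈ unitSphere n | suppFn K u = 0} := by
    rintro u ⟨⟨h1, h2, h3⟩, h4⟩
    rcases (supp_nonneg hK h0 u).lt_or_eq with h | h
    · exact Or.inl ⟨⟨h1, h2, h3, h⟩, h4⟩
    · exact Or.inr ⟨h1, h.symm⟩
  calc _ ≤ μH[d] (χ '' (Ω ∩ S)) := measure_mono hsub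
    _ ≤ (L : ℝ≥0∞) ^ d * μH[d] (Ω ∩ S) :=
        (hlip.mono inter_subset_left).hausdorffMeasure_image_le hn
    _ ≤ _ := by
        refine mul_le_mul_right ?_ _
        refine (measure_mono hsplit).trans ((measure_union_le _ _).trans ?_)
        rw [hnull, add_zero]

lemma doubling (hn : 2 ≤ n) {p : ℝ} (hp : p < 1) {τ1 τ2 : ℝ}
    (hτ1 : 0 < τ1) (hτ12 : τ1 < τ2) {f : EuclideanSpace ℝ (Fin n) → ℝ}
    (hf : ∀ u ∈ unitSphere n, τ1 < f u ∧ f u < τ2)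
    (hK : IsConvexBody0 K) (hsol : IsLpSolution p f K) (he : ‖e‖ = 1)
    {R : ℝ} (hR : 0 ≤ R) {z1 : Fe e} (hz : ‖z1‖ ≤ R) {C0 : ℝ} (hC0 : 0 ≤ C0) :
    ∃ C : ℝ≥0∞, C ≠ ⊤ ∧ ∀ A : Set (Fe e), MeasurableSet A → (∀ w ∈ A, ‖w‖ ≤ R) →
      (∀ w ∈ A, suppFn K (e + z1) ≤ C0 * suppFn K (e + w)) →
      μH[(n : ℝ) - 1] (⋃ w ∈ {w ∈ A | 0 < suppFn K (e + w)}, face K (e + w)) ≤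
      C * μH[(n : ℝ) - 1] (⋃ w ∈ {w ∈ {w : Fe e | (2 : ℝ) • w - z1 ∈ A} | 0 < suppFn K (e + w)},
        face K (e + w)) := by
  obtain ⟨hKc, hKconv, _, h0⟩ := hK
  have hne : K.Nonempty := ⟨0, h0⟩
  obtain ⟨hnull, hsol⟩ := hsol
  have hn0 : (0:ℝ) < n := by exact_mod_cast (by omega : 0 < n)
  have hn1 : (0:ℝ) ≤ (n:ℝ) - 1 := by
    have : (2:ℝ) ≤ n := by exact_mod_cast hn
    linarith
  set C1 : ℝ := (C0 + 1) / 2 * (1 + R) with hC1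
  have hC1pos : 0 < C1 := by positivity
  set c : ℝ := τ2 / τ1 * C1 ^ (1 - p) with hc
  have hcpos : 0 < c := by
    have : 0 < τ2 := hτ1.trans hτ12
    positivity
  set L : ℝ≥0∞ := ((Real.toNNReal (4 * ((1 + R) + (1 + R) ^ 2)) : ℝ≥0) : ℝ≥0∞) ^ ((n : ℝ) - 1)
    with hL
  refine ⟨ENNReal.ofReal c * L, ENNReal.mul_ne_top ENNReal.ofReal_ne_top
    (ENNReal.rpow_ne_top_of_nonneg hn1 ENNReal.coe_ne_top), fun A hA hAR hAC => ?_⟩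
  set A' : Set (Fe e) := {w | (2 : ℝ) • w - z1 ∈ A} with hA'
  have hA'm : MeasurableSet A' := (by fun_prop : Continuous fun w : Fe e => (2:ℝ) • w - z1).measurable hA
  have hωm := omg_measurable hKc hne hA
  have hω'm := omg_measurable hKc hne hA'm
  have hS := hsol _ hωm (fun u hu => ⟨hu.1, hu.2.2.2⟩)
  have hS' := hsol _ hω'm (fun u hu => ⟨hu.1, hu.2.2.2⟩)
  rw [surfMeas, omg_faces hKc hne he] at hS hS'
  rw [hS, hS']
  set ψ : EuclideanSpace ℝ (Fin n) → EuclideanSpace ℝ (Fin n) :=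
    fun u => nu e ((1/2 : ℝ) • (gno e u + z1)) with hψ
  have hψm : Measurable ψ := by
    have h1 : Measurable fun u => (1/2 : ℝ) • (gno e u + z1) :=
      (by fun_prop : Continuous fun w : Fe e => (1/2 : ℝ) • (w + z1)).measurable.comp
        gno_measurable
    exact (nu_continuous he).measurable.comp h1
  classical
  set G : EuclideanSpace ℝ (Fin n) → ℝ≥0∞ := fun u =>
    if 0 < suppFn K u then ENNReal.ofReal (n * τ1 * suppFn K u ^ (p - 1)) else ⊤ with hG
  have hsm : Measurable (suppFn K) := (supp_continuous hKc hne).measurable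
  have hGm : Measurable G := by
    refine Measurable.ite (measurableSet_lt measurable_const hsm) ?_ measurable_const
    exact ENNReal.measurable_ofReal.comp ((hsm.pow_const _).const_mul _)
  have hmeas : ((μH[(n:ℝ) - 1] : Measure (EuclideanSpace ℝ (Fin n))).restrict (omg K e A)).map ψ ≤
      L • (μH[(n:ℝ) - 1] : Measure (EuclideanSpace ℝ (Fin n))).restrict (omg K e A') := by
    rw [Measure.le_iff]
    intro S hSm
    rw [Measure.map_apply hψm hSm, Measure.restrict_apply (hψm hSm), Measure.smul_apply,
      Measure.restrict_apply hSm, inter_comm, inter_comm S, smul_eq_mul]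
    exact doubling_meas hKc h0 he hn1 hnull hR hz A hAR S
  have hpt : ∀ u ∈ omg K e A, ENNReal.ofReal ((n : ℝ) * f u * suppFn K u ^ (p - 1)) ≤
      ENNReal.ofReal c * G (ψ u) := by
    rintro u ⟨h1, h2, h3, h4⟩
    by_cases hpos : 0 < suppFn K (ψ u)
    · simp only [hG, if_pos hpos]
      rw [← ENNReal.ofReal_mul hcpos.le]
      apply ENNReal.ofReal_le_ofReal
      set y' := gno e u with hy'
      set y := (1/2 : ℝ) • (gno e u + z1) with hy
      have hu : suppFn K u = ⟪e, u⟫ * suppFn K (e + y') := by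
        conv_lhs => rw [gno_smul he h2]
        exact supp_smul hKc hne _ h2.le
      have hk0 : 0 ≤ suppFn K (e + y') := supp_nonneg hKc h0 _
      have b1 : suppFn K (ψ u) ≤ suppFn K (e + y) := by
        have : ψ u = ‖e + (y : EuclideanSpace ℝ (Fin n))‖⁻¹ • (e + (y : EuclideanSpace ℝ (Fin n))) := rfl
        rw [this, supp_smul hKc hne _ (by positivity)]
        exact mul_le_of_le_one_left (supp_nonneg hKc h0 _) (inv_le_one_of_one_le₀ (norm_slice_ge he y))
      have b2 : suppFn K (e + y) ≤ 1/2 * (suppFn K (e + y') + suppFn K (e + z1)) := by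
        have : e + (y : EuclideanSpace ℝ (Fin n)) = (1/2 : ℝ) • ((e + (y' : EuclideanSpace ℝ (Fin n))) + (e + z1)) := by
          rw [hy]; push_cast; module
        rw [this, supp_smul hKc hne _ (by norm_num)]
        gcongr
        exact supp_add hKc hne _ _
      have b3 := hAC y' h3
      have b4 : suppFn K (e + y') ≤ (1 + R) * suppFn K u := by
        have h5 := inner_mul_norm he h1 h2
        have h6 : ‖e + (y' : EuclideanSpace ℝ (Fin n))‖ ≤ 1 + R :=
          norm_slice_le he (hAR _ h3)
        have h7 : 1 ≤ ⟪e, u⟫ * (1 + R) := h5.symm.le.trans (mul_le_mul_of_nonneg_left h6 h2.le)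
        rw [hu]
        calc suppFn K (e + y') = 1 * suppFn K (e + y') := by ring
          _ ≤ (⟪e, u⟫ * (1 + R)) * suppFn K (e + y') := by gcongr
          _ = _ := by ring
      have b5 : suppFn K (ψ u) ≤ C1 * suppFn K u := by
        calc suppFn K (ψ u) ≤ (C0 + 1) / 2 * suppFn K (e + y') := by linarith
          _ ≤ (C0 + 1) / 2 * ((1 + R) * suppFn K u) := by gcongr
          _ = _ := by rw [hC1]; ring
      have b6 : (C1 * suppFn K u) ^ (p - 1) ≤ suppFn K (ψ u) ^ (p - 1) :=
        Real.rpow_le_rpow_of_nonpos hpos b5 (by linarith)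
      rw [Real.mul_rpow hC1pos.le h4.le] at b6
      have b7 : C1 ^ (1 - p) * C1 ^ (p - 1) = 1 := by
        rw [← Real.rpow_add hC1pos]; simp
      have hfu := (hf u h1).2.le
      have hr : 0 ≤ suppFn K u ^ (p - 1) := Real.rpow_nonneg h4.le _
      calc (n : ℝ) * f u * suppFn K u ^ (p - 1) ≤ n * τ2 * suppFn K u ^ (p - 1) := by gcongr
        _ = n * τ2 * (C1 ^ (1 - p) * (C1 ^ (p - 1) * suppFn K u ^ (p - 1))) := by
            rw [← mul_assoc (C1 ^ (1 - p)), b7, one_mul]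
        _ ≤ n * τ2 * (C1 ^ (1 - p) * suppFn K (ψ u) ^ (p - 1)) := by
            have : 0 < τ2 := hτ1.trans hτ12
            gcongr
        _ = c * (n * τ1 * suppFn K (ψ u) ^ (p - 1)) := by rw [hc]; field_simp
    · simp only [hG, if_neg hpos]
      rw [ENNReal.mul_top (by simpa using hcpos)]
      exact le_top
  calc _ ≤ ∫⁻ u in omg K e A, ENNReal.ofReal c * G (ψ u) ∂μH[(n:ℝ) - 1] :=
        setLIntegral_mono' hωm hpt
    _ = ENNReal.ofReal c * ∫⁻ u in omg K e A, G (ψ u) ∂μH[(n:ℝ) - 1] :=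
        lintegral_const_mul _ (hGm.comp hψm)
    _ = ENNReal.ofReal c * ∫⁻ u, G u ∂(((μH[(n:ℝ) - 1] :
          Measure (EuclideanSpace ℝ (Fin n))).restrict (omg K e A)).map ψ) := by
        rw [lintegral_map hGm hψm]
    _ ≤ ENNReal.ofReal c * ∫⁻ u, G u ∂(L • (μH[(n:ℝ) - 1] :
          Measure (EuclideanSpace ℝ (Fin n))).restrict (omg K e A')) := by
        gcongr
    _ = ENNReal.ofReal c * L * ∫⁻ u in omg K e A', G u ∂μH[(n:ℝ) - 1] := by
        rw [lintegral_smul_measure, smul_eq_mul, mul_assoc]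
    _ ≤ _ := by
        refine mul_le_mul_right ?_ _
        refine setLIntegral_mono' hω'm fun u hu => ?_
        simp only [hG, if_pos hu.2.2.2]
        apply ENNReal.ofReal_le_ofReal
        have := (hf u hu.1).1.le
        have hr : 0 ≤ suppFn K u ^ (p - 1) := Real.rpow_nonneg hu.2.2.2.le _
        gcongr

end doubling

section core
variable {n : ℕ} {K : Set (EuclideanSpace ℝ (Fin n))} {e : EuclideanSpace ℝ (Fin n)}

/-- Support function of `K - x` on the slice. -/
def vfun (K : Set (EuclideanSpace ℝ (Fin n))) (e x : EuclideanSpace ℝ (Fin n)) (w : Fe e) : ℝ :=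
  suppFn K (e + w) - ⟪e + (w : EuclideanSpace ℝ (Fin n)), x⟫

/-- The sections. -/
def Tset (K : Set (EuclideanSpace ℝ (Fin n))) (e x : EuclideanSpace ℝ (Fin n)) (a u2 : Fe e)
    (ε : ℝ) : Set (Fe e) := {w | vfun K e x w ≤ ε * ⟪a, w - u2⟫}

lemma vfun_eq (x : EuclideanSpace ℝ (Fin n)) (w : Fe e) :
    vfun K e x w = suppFn K (e + w) - ⟪e, x⟫ - ⟪Pe e x, w⟫ := by
  rw [vfun, inner_slice, real_inner_comm w]; ring

lemma vfun_nonneg (hK : IsCompact K) {x : EuclideanSpace ℝ (Fin n)} (hx : x ∈ K) (w : Fe e) :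
    0 ≤ vfun K e x w := by
  have := le_supp hK (e + w) hx
  rw [vfun]; linarith

lemma vfun_continuous (hK : IsCompact K) (hne : K.Nonempty) (x : EuclideanSpace ℝ (Fin n)) :
    Continuous (vfun K e x) := by
  unfold vfun
  exact ((supp_continuous hK hne).comp (by fun_prop)).sub (by fun_prop)

lemma hh_convex (hK : IsCompact K) (hne : K.Nonempty) (w w' : Fe e) {a b : ℝ} (ha : 0 ≤ a)
    (hb : 0 ≤ b) (hab : a + b = 1) :
    suppFn K (e + ((a • w + b • w' : Fe e) : EuclideanSpace ℝ (Fin n))) ≤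
      a * suppFn K (e + w) + b * suppFn K (e + w') := by
  have h := (supp_convex hK hne).2 (mem_univ (e + (w : EuclideanSpace ℝ (Fin n))))
    (mem_univ (e + (w' : EuclideanSpace ℝ (Fin n)))) ha hb hab
  have h2 : e + ((a • w + b • w' : Fe e) : EuclideanSpace ℝ (Fin n)) =
      a • (e + (w : EuclideanSpace ℝ (Fin n))) + b • (e + (w' : EuclideanSpace ℝ (Fin n))) := by
    rw [show b = 1 - a by linarith]
    push_cast
    module
  rw [h2]
  exact h

lemma vfun_convex (hK : IsCompact K) (hne : K.Nonempty) (x : EuclideanSpace ℝ (Fin n)) (w w' : Fe e)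
    {a b : ℝ} (ha : 0 ≤ a) (hb : 0 ≤ b) (hab : a + b = 1) :
    vfun K e x (a • w + b • w') ≤ a * vfun K e x w + b * vfun K e x w' := by
  have h := hh_convex hK hne w w' ha hb hab
  rw [vfun_eq, vfun_eq, vfun_eq, inner_add_right, real_inner_smul_right, real_inner_smul_right]
  have : ⟪e, x⟫ = a * ⟪e, x⟫ + b * ⟪e, x⟫ := by rw [← add_mul, hab, one_mul]
  linarith

lemma Tset_closed (hK : IsCompact K) (hne : K.Nonempty) (x : EuclideanSpace ℝ (Fin n))
    (a u2 : Fe e) (ε : ℝ) : IsClosed (Tset K e x a u2 ε) :=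
  isClosed_le (vfun_continuous hK hne x) (by fun_prop)

lemma Tset_mono (hK : IsCompact K) {x : EuclideanSpace ℝ (Fin n)} (hx : x ∈ K) (a u2 : Fe e)
    {ε ε' : ℝ} (hε : 0 < ε) (h : ε ≤ ε') : Tset K e x a u2 ε ⊆ Tset K e x a u2 ε' := by
  intro w hw
  have h1 : vfun K e x w ≤ ε * ⟪a, w - u2⟫ := hw
  have h2 := vfun_nonneg hK hx w
  have h3 : 0 ≤ ⟪a, w - u2⟫ := nonneg_of_mul_nonneg_right (h2.trans h1) hε
  exact h1.trans (by gcongr)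

lemma lower_incl (hK : IsCompact K) (hc : Convex ℝ K) (hne : K.Nonempty) (he : ‖e‖ = 1)
    {x : EuclideanSpace ℝ (Fin n)} {a u0 u2 : Fe e} {ε : ℝ} (hε : 0 < ε)
    (hT : IsCompact (Tset K e x a u2 ε)) (hv0 : vfun K e x u0 = 0) (ha : ⟪a, u0 - u2⟫ = 2)
    {s : Fe e} (hs : s ∈ polarAt (Tset K e x a u2 ε) u0) :
    ∃ w : Fe e, vfun K e x w < ε * ⟪a, w - u2⟫ ∧
      ∃ q ∈ face K (e + w), Pe e q = (Pe e x + ε • a) + ε • s := by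
  have hvc := vfun_continuous (e := e) hK hne x
  set φ : Fe e → ℝ := fun w => vfun K e x w - ε * ⟪a, w - u2⟫ - ε * ⟪s, w⟫ with hφ
  have hφc : Continuous φ := (hvc.sub (by fun_prop)).sub (by fun_prop)
  have hu0 : u0 ∈ Tset K e x a u2 ε := by
    change vfun K e x u0 ≤ ε * ⟪a, u0 - u2⟫
    rw [hv0, ha]; positivity
  obtain ⟨w, hw, hmin⟩ := hT.exists_isMinOn ⟨u0, hu0⟩ hφc.continuousOn
  have hw' : vfun K e x w ≤ ε * ⟪a, w - u2⟫ := hw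
  have hlt : vfun K e x w < ε * ⟪a, w - u2⟫ := by
    refine lt_of_le_of_ne hw' fun heq => ?_
    have h1 : φ w ≤ φ u0 := hmin hu0
    have h2 := hs w hw
    simp only [hφ, hv0, ha, heq] at h1
    rw [inner_sub_right] at h2
    nlinarith
  refine ⟨w, hlt, ?_⟩
  have hopen : IsOpen {w : Fe e | vfun K e x w < ε * ⟪a, w - u2⟫} :=
    isOpen_lt hvc (by fun_prop)
  have hloc : IsLocalMin φ w := by
    filter_upwards [hopen.mem_nhds hlt] with y hy
    exact hmin (show y ∈ Tset K e x a u2 ε from le_of_lt hy)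
  have hφconv : ConvexOn ℝ univ φ := by
    refine ⟨convex_univ, fun y _ y' _ α β hα hβ hαβ => ?_⟩
    have := vfun_convex (e := e) hK hne x y y' hα hβ hαβ
    simp only [hφ, inner_sub_right, inner_add_right, real_inner_smul_right, smul_eq_mul]
    have h2 : ⟪a, u2⟫ = α * ⟪a, u2⟫ + β * ⟪a, u2⟫ := by rw [← add_mul, hαβ, one_mul]
    have h3 : ε * ⟪a, u2⟫ = ε * (α * ⟪a, u2⟫ + β * ⟪a, u2⟫) := by rw [← h2]
    linarith
  have hglob := IsMinOn.of_isLocalMin_of_convex_univ hloc hφconv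
  apply subgrad_face hK hc hne he
  intro w'
  have h := hglob w'
  simp only [hφ, vfun_eq, inner_sub_right] at h
  simp only [inner_add_left, real_inner_smul_left, inner_sub_right]
  linarith

lemma upper_incl (hK : IsCompact K) (hne : K.Nonempty)
    {x : EuclideanSpace ℝ (Fin n)} (hx : x ∈ K) {a u2 z1 y : Fe e} {ε : ℝ} (hε : 0 < ε)
    (hl : ∀ w ∈ Tset K e x a u2 ε, ⟪a, w - u2⟫ ≤ 3) (hz1 : z1 ∈ Tset K e x a u2 ε)
    (hy : (2 : ℝ) • y - z1 ∈ Tset K e x a u2 ε) {q : EuclideanSpace ℝ (Fin n)}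
    (hq : q ∈ face K (e + y)) :
    ∃ s ∈ polarAt (Tset K e x a u2 ε) z1, Pe e q = (Pe e x + ε • a) + (6 * ε) • s := by
  have hconv : ∀ w ∈ Tset K e x a u2 ε, ∀ w' ∈ Tset K e x a u2 ε,
      (1/2 : ℝ) • w + (1/2 : ℝ) • w' ∈ Tset K e x a u2 ε := by
    intro w hw w' hw'
    have h1 : vfun K e x w ≤ ε * ⟪a, w - u2⟫ := hw
    have h2 : vfun K e x w' ≤ ε * ⟪a, w' - u2⟫ := hw'
    have h3 := vfun_convex (e := e) hK hne x w w' (a := 1/2) (b := 1/2) (by norm_num) (by norm_num)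
      (by norm_num)
    change vfun K e x _ ≤ ε * ⟪a, _ - u2⟫
    rw [inner_sub_right] at h1 h2 ⊢
    rw [inner_add_right, real_inner_smul_right, real_inner_smul_right]
    linarith
  refine ⟨(6 * ε)⁻¹ • (Pe e q - (Pe e x + ε • a)), ?_, ?_⟩
  · intro w hw
    rw [real_inner_smul_left, inv_mul_le_iff₀ (by positivity), mul_one]
    have h1 := hconv _ hy w hw
    set w1 := (1/2 : ℝ) • ((2:ℝ) • y - z1) + (1/2 : ℝ) • w with hw1
    have e1 : w - z1 = (2:ℝ) • (w1 - y) := by rw [hw1]; module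
    have h2 := face_subgrad hK hq w1
    have h3 : vfun K e x w1 ≤ ε * ⟪a, w1 - u2⟫ := h1
    have hyT : y ∈ Tset K e x a u2 ε := by
      have := hconv _ hy z1 hz1
      have e2 : (1/2 : ℝ) • ((2:ℝ) • y - z1) + (1/2 : ℝ) • z1 = y := by module
      rwa [e2] at this
    have h4 := vfun_nonneg hK hx y
    have h5 := hl y hyT
    have h6 : ε * ⟪a, y - u2⟫ ≤ ε * 3 := by gcongr
    rw [vfun_eq] at h3 h4
    rw [e1, real_inner_smul_right]
    simp only [inner_sub_left, inner_add_left, real_inner_smul_left, inner_sub_right] at *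
    linarith
  · rw [smul_smul, mul_inv_cancel₀ (by positivity), one_smul]; abel

lemma faces_X0 (hK : IsCompact K) (he : ‖e‖ = 1)
    (h0 : (0 : EuclideanSpace ℝ (Fin n)) ∈ K) {A : Set (Fe e)} (hA : IsOpen A) :
    (⋃ w ∈ A, face K (e + w)) ⊆ {x ∈ frontier K | normalCone K x ⊆ normalCone K 0} ∪
      ⋃ w ∈ {w ∈ A | 0 < suppFn K (e + w)}, face K (e + w) := by
  intro q hq
  simp only [mem_iUnion, exists_prop] at hq
  obtain ⟨w, hw, hq⟩ := hq
  rcases (supp_nonneg hK h0 (e + w)).lt_or_eq with hpos | hzero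
  · right
    simp only [mem_iUnion, exists_prop]
    exact ⟨w, ⟨hw, hpos⟩, hq⟩
  obtain ⟨hqK, hqn⟩ := (mem_face_iff hK _ _).1 hq
  set u := e + (w : EuclideanSpace ℝ (Fin n)) with hu
  have huq : ⟪u, q⟫ = 0 := by rw [real_inner_comm, hq.2, ← hzero]
  by_cases hX : normalCone K q ⊆ normalCone K 0
  · left
    refine ⟨⟨subset_closure hqK, fun hint => ?_⟩, hX⟩
    obtain ⟨r, hr, hb⟩ := Metric.isOpen_iff.1 isOpen_interior q hint
    have hu0 : 0 < ‖u‖ := slice_pos he w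
    have hm : q + (r / 2 / ‖u‖) • u ∈ K := by
      apply interior_subset
      apply hb
      rw [mem_ball_iff_norm, add_sub_cancel_left, norm_smul, Real.norm_of_nonneg (by positivity)]
      field_simp
      linarith
    have := hqn _ hm
    rw [inner_add_right, real_inner_smul_right, real_inner_self_eq_norm_sq] at this
    have : 0 < r / 2 / ‖u‖ * ‖u‖ ^ 2 := by positivity
    linarith
  · right
    rw [Set.not_subset] at hX
    obtain ⟨u', hu', hnot⟩ := hX
    have hpos : 0 < ⟪u', q⟫ := by
      by_contra hle
      push Not at hle
      apply hnot
      intro y hy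
      rw [inner_zero_right]
      exact (hu' y hy).trans hle
    set c : ℝ → ℝ := fun t => 1 + t * ⟪e, u'⟫ with hc
    have hcc : Continuous c := by fun_prop
    have hc0 : c 0 = 1 := by simp [hc]
    set wt : ℝ → Fe e := fun t => (c t)⁻¹ • (w + t • Pe e u') with hwt
    have hcont : ContinuousAt wt 0 := by
      refine ContinuousAt.smul (hcc.continuousAt.inv₀ (by rw [hc0]; norm_num)) (by fun_prop)
    have hwt0 : wt 0 = w := by simp [hwt, hc0]
    have hev : ∀ᶠ t in nhds (0:ℝ), wt t ∈ A ∧ 0 < c t :=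
      (hcont.eventually (by rw [hwt0]; exact hA.mem_nhds hw)).and
        (hcc.continuousAt.eventually (by rw [hc0]; exact lt_mem_nhds one_pos))
    obtain ⟨t, ⟨htA, htc⟩, ht⟩ :=
      ((hev.filter_mono nhdsWithin_le_nhds).and (self_mem_nhdsWithin (s := Ioi (0:ℝ)))).exists
    have ht0 : (0:ℝ) < t := ht
    have heq : e + (wt t : EuclideanSpace ℝ (Fin n)) = (c t)⁻¹ • (u + t • u') := by
      have h1 := decomp he u'
      have h2 : u + t • u' = c t • e + (w + t • (Pe e u' : EuclideanSpace ℝ (Fin n))) := by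
        conv_lhs => rw [h1]
        rw [hu, hc]
        module
      rw [h2, smul_add, smul_smul, inv_mul_cancel₀ htc.ne', one_smul, hwt]
      simp
    have hface : q ∈ face K (u + t • u') := by
      rw [mem_face_iff hK]
      refine ⟨hqK, fun y hy => ?_⟩
      rw [inner_add_left u (t • u'), inner_add_left u (t • u'), real_inner_smul_left,
        real_inner_smul_left]
      have h1 := hqn y hy
      have h2 := hu' y hy
      have h3 := mul_le_mul_of_nonneg_left h2 ht0.le
      linarith
    simp only [mem_iUnion, exists_prop]
    refine ⟨wt t, ⟨htA, ?_⟩, ?_⟩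
    · rw [heq, supp_smul hK ⟨0, h0⟩ _ (inv_pos.2 htc).le, ← hface.2, real_inner_comm,
        inner_add_left u (t • u'), real_inner_smul_left, huq]
      have := inv_pos.2 htc
      have := mul_pos ht0 hpos
      rw [zero_add]
      positivity
    · rw [heq, face_smul hK _ (inv_pos.2 htc)]
      exact hface

end core

section core2
variable {n : ℕ} {K : Set (EuclideanSpace ℝ (Fin n))} {e : EuclideanSpace ℝ (Fin n)}

lemma finrank_Fe (hn : 2 ≤ n) (he : ‖e‖ = 1) : (Module.finrank ℝ (Fe e) : ℝ) = (n : ℝ) - 1 := by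
  have hne : e ≠ 0 := by
    intro h; rw [h, norm_zero] at he; exact zero_ne_one he
  have : Fact (Module.finrank ℝ (EuclideanSpace ℝ (Fin n)) = (n - 1) + 1) :=
    ⟨by rw [finrank_euclideanSpace_fin]; omega⟩
  have h := Submodule.finrank_orthogonal_span_singleton (𝕜 := ℝ) (n := n - 1) hne
  rw [Fe, h, Nat.cast_sub (by omega)]
  simp

lemma aff_meas {F : Type*} [NormedAddCommGroup F] [InnerProductSpace ℝ F] [FiniteDimensional ℝ F]
    [MeasurableSpace F] [BorelSpace F] (μ : Measure F) [μ.IsAddHaarMeasure] (b : F) {r : ℝ}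
    (hr : 0 < r) (P : Set F) :
    μ ((fun s => b + r • s) '' P) = ENNReal.ofReal (r ^ Module.finrank ℝ F) * μ P := by
  have h1 : (fun s => b + r • s) '' P = (fun x => b + x) '' ((fun s => r • s) '' P) := by
    rw [image_image]
  have h2 : μ ((fun s => r • s) '' P) = ENNReal.ofReal |r ^ Module.finrank ℝ F| * μ P :=
    Measure.addHaar_smul μ r P
  rw [h1, image_add_left, measure_preimage_add, h2, abs_of_pos (by positivity)]

lemma Tset_growth {x : EuclideanSpace ℝ (Fin n)} {a u2 : Fe e} {r R0 : ℝ} (hr : 0 < r)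
    (hg : ∀ w : Fe e, r * ‖w‖ - R0 ≤ vfun K e x w) {ε : ℝ} (hε : 0 ≤ ε)
    (hε1 : ε * ‖a‖ ≤ r / 2) {w : Fe e} (hw : w ∈ Tset K e x a u2 ε) :
    ‖w‖ ≤ 2 * R0 / r + ‖u2‖ := by
  have h1 : vfun K e x w ≤ ε * ⟪a, w - u2⟫ := hw
  have h2 := hg w
  have h3 : ε * ⟪a, w - u2⟫ ≤ ε * (‖a‖ * (‖w‖ + ‖u2‖)) := by
    gcongr
    exact (real_inner_le_norm _ _).trans (by gcongr; exact norm_sub_le _ _)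
  have h4 : ε * (‖a‖ * (‖w‖ + ‖u2‖)) ≤ r / 2 * (‖w‖ + ‖u2‖) := by
    rw [← mul_assoc]; gcongr
  have h5 : r * ‖w‖ ≤ r * (2 * R0 / r + ‖u2‖) := by
    have : r * (2 * R0 / r + ‖u2‖) = 2 * R0 + r * ‖u2‖ := by field_simp
    rw [this]; nlinarith
  exact le_of_mul_le_mul_left h5 hr

lemma Tset_compact (hK : IsCompact K) (hne : K.Nonempty) {x : EuclideanSpace ℝ (Fin n)}
    {a u2 : Fe e} {r R0 : ℝ} (hr : 0 < r)
    (hg : ∀ w : Fe e, r * ‖w‖ - R0 ≤ vfun K e x w) {ε : ℝ} (hε : 0 ≤ ε)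
    (hε1 : ε * ‖a‖ ≤ r / 2) : IsCompact (Tset K e x a u2 ε) := by
  refine Metric.isCompact_of_isClosed_isBounded (Tset_closed hK hne x a u2 ε) ?_
  refine (Metric.isBounded_closedBall (x := (0 : Fe e)) (r := 2 * R0 / r + ‖u2‖)).subset ?_
  intro w hw
  rw [mem_closedBall_zero_iff]
  exact Tset_growth hr hg hε hε1 hw

lemma Tset_shrink (hK : IsCompact K) (hne : K.Nonempty) {x : EuclideanSpace ℝ (Fin n)} (hx : x ∈ K)
    {a u2 : Fe e} {r R0 : ℝ} (hr : 0 < r)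
    (hg : ∀ w : Fe e, r * ‖w‖ - R0 ≤ vfun K e x w) {ε1 : ℝ} (hε : 0 < ε1)
    (hε1 : ε1 * ‖a‖ ≤ r / 2) {U : Set (Fe e)} (hU : IsOpen U)
    (hsub : ∀ w, vfun K e x w = 0 → 0 ≤ ⟪a, w - u2⟫ → w ∈ U) :
    ∃ ε0, 0 < ε0 ∧ ε0 ≤ ε1 ∧ ∀ ε, 0 < ε → ε ≤ ε0 → Tset K e x a u2 ε ⊆ U := by
  set V : ℕ → Set (Fe e) := fun k => Tset K e x a u2 (ε1 / (k + 1)) with hV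
  have hpos : ∀ k : ℕ, 0 < ε1 / ((k : ℝ) + 1) := fun k => by positivity
  have hle : ∀ k : ℕ, ε1 / ((k : ℝ) + 1) ≤ ε1 := fun k => div_le_self hε.le (by
    have : (0:ℝ) ≤ k := Nat.cast_nonneg k
    linarith)
  have hanti : Antitone V := by
    intro i j hij
    apply Tset_mono hK hx a u2 (hpos j)
    have : (i : ℝ) ≤ j := by exact_mod_cast hij
    gcongr
  have hcpt : ∀ k, IsCompact (V k) := fun k => by
    apply Tset_compact hK hne hr hg (hpos k).le
    exact (mul_le_mul_of_nonneg_right (hle k) (norm_nonneg _)).trans hε1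
  have hdir : Directed (fun x1 x2 => x1 ⊇ x2) V := directed_of_isDirected_le hanti
  obtain ⟨k, hk⟩ := exists_subset_nhds_of_isCompact (V := V) hdir hcpt (U := U) (by
    intro w hw
    apply hU.mem_nhds
    rw [mem_iInter] at hw
    have h1 : ∀ k : ℕ, vfun K e x w ≤ ε1 / ((k : ℝ) + 1) * ⟪a, w - u2⟫ := hw
    have h2 := vfun_nonneg hK hx w
    apply hsub
    · refine le_antisymm ?_ h2
      have ht : Filter.Tendsto (fun k : ℕ => ε1 / ((k : ℝ) + 1) * ⟪a, w - u2⟫) Filter.atTop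
          (nhds (0 * ⟪a, w - u2⟫)) := by
        apply Filter.Tendsto.mul_const
        have := (tendsto_one_div_add_atTop_nhds_zero_nat (𝕜 := ℝ)).const_mul ε1
        simpa [div_eq_mul_inv] using this
      rw [zero_mul] at ht
      exact ge_of_tendsto' ht h1
    · exact nonneg_of_mul_nonneg_right (h2.trans (h1 0)) (hpos 0))
  exact ⟨ε1 / ((k : ℝ) + 1), hpos k, hle k, fun ε h1 h2 =>
    (Tset_mono hK hx a u2 h1 h2).trans hk⟩

lemma core_chain (hn : 2 ≤ n) (hK : IsCompact K) (hc : Convex ℝ K)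
    (h0 : (0 : EuclideanSpace ℝ (Fin n)) ∈ K) (he : ‖e‖ = 1)
    (hX0 : μH[(n : ℝ) - 1] {x ∈ frontier K | normalCone K x ⊆ normalCone K 0} = 0)
    {x : EuclideanSpace ℝ (Fin n)} (hx : x ∈ K) {a u0 u2 z1 : Fe e} {ε : ℝ} (hε : 0 < ε)
    (hT : IsCompact (Tset K e x a u2 ε)) (hv0 : vfun K e x u0 = 0) (ha : ⟪a, u0 - u2⟫ = 2)
    {R : ℝ} (hR : 0 ≤ R) (hTR : ∀ w ∈ Tset K e x a u2 ε, ‖w‖ ≤ R)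
    (hl : ∀ w ∈ Tset K e x a u2 ε, ⟪a, w - u2⟫ ≤ 3) (hz1 : z1 ∈ Tset K e x a u2 ε)
    {C : ℝ≥0∞}
    (hdbl : ∀ A : Set (Fe e), MeasurableSet A → A ⊆ Tset K e x a u2 ε →
      μH[(n : ℝ) - 1] (⋃ w ∈ {w ∈ A | 0 < suppFn K (e + w)}, face K (e + w)) ≤
      C * μH[(n : ℝ) - 1] (⋃ w ∈ {w ∈ {w : Fe e | (2 : ℝ) • w - z1 ∈ A} | 0 < suppFn K (e + w)},
        face K (e + w)))
    (μ : Measure (Fe e)) [μ.IsAddHaarMeasure] (hμ : μ = μH[(n : ℝ) - 1]) :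
    μ (polarAt (Tset K e x a u2 ε) u0) ≤
      C * ENNReal.ofReal ((1 + R) ^ ((n : ℝ) - 1)) *
        ENNReal.ofReal (6 ^ Module.finrank ℝ (Fe e)) * μ (polarAt (Tset K e x a u2 ε) z1) := by
  have hne : K.Nonempty := ⟨0, h0⟩
  have hd : (0:ℝ) ≤ (n : ℝ) - 1 := by
    have : (2:ℝ) ≤ n := by exact_mod_cast hn
    linarith
  set T := Tset K e x a u2 ε with hTdef
  set k := Module.finrank ℝ (Fe e)
  set A : Set (Fe e) := {w | vfun K e x w < ε * ⟪a, w - u2⟫} with hA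
  have hAo : IsOpen A := isOpen_lt (vfun_continuous hK hne x) (by fun_prop)
  have hAT : A ⊆ T := fun w hw => le_of_lt (show vfun K e x w < ε * ⟪a, w - u2⟫ from hw)
  set b : Fe e := Pe e x + ε • a with hb
  set A2 : Set (Fe e) := {w ∈ {w : Fe e | (2 : ℝ) • w - z1 ∈ A} | 0 < suppFn K (e + w)} with hA2
  have s1 : ENNReal.ofReal (ε ^ k) * μ (polarAt T u0) ≤
      μ (Pe e '' (⋃ w ∈ A, face K (e + w))) := by
    rw [← aff_meas μ b hε]
    apply measure_mono
    rintro _ ⟨s, hs, rfl⟩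
    obtain ⟨w, hw, q, hq, hqe⟩ := lower_incl hK hc hne he hε hT hv0 ha hs
    refine ⟨q, ?_, hqe⟩
    simp only [mem_iUnion, exists_prop]
    exact ⟨w, hw, hq⟩
  have s2 : μ (Pe e '' (⋃ w ∈ A, face K (e + w))) ≤ μH[(n : ℝ) - 1] (⋃ w ∈ A, face K (e + w)) := by
    rw [hμ]; exact proj_meas_le hd _
  have s3 : μH[(n : ℝ) - 1] (⋃ w ∈ A, face K (e + w)) ≤
      μH[(n : ℝ) - 1] (⋃ w ∈ {w ∈ A | 0 < suppFn K (e + w)}, face K (e + w)) := by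
    refine (measure_mono (faces_X0 hK he h0 hAo)).trans ((measure_union_le _ _).trans ?_)
    rw [hX0, zero_add]
  have s4 := hdbl A hAo.measurableSet hAT
  have hA2R : ∀ w ∈ A2, ‖w‖ ≤ R := by
    intro w hw
    have h1 := hTR _ (hAT hw.1)
    have h2 := hTR _ hz1
    have h3 : w = (1/2 : ℝ) • (((2:ℝ) • w - z1) + z1) := by module
    rw [h3, norm_smul]
    have h4 := norm_add_le ((2:ℝ) • w - z1) z1
    rw [Real.norm_of_nonneg (by norm_num)]
    linarith
  have s5 := faces_meas_le hK he hR hd A2 hA2R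
  have s6 : μH[(n : ℝ) - 1] (Pe e '' (⋃ w ∈ A2, face K (e + w))) ≤
      ENNReal.ofReal ((6 * ε) ^ k) * μ (polarAt T z1) := by
    rw [← hμ, ← aff_meas μ b (by positivity : 0 < 6 * ε)]
    apply measure_mono
    rintro _ ⟨q, hq, rfl⟩
    simp only [mem_iUnion, exists_prop] at hq
    obtain ⟨y, hy, hq⟩ := hq
    obtain ⟨s, hs, hqs⟩ := upper_incl hK hne hx hε hl hz1 (hAT hy.1) hq
    exact ⟨s, hs, hqs.symm⟩
  have s7 : ENNReal.ofReal (ε ^ k) * μ (polarAt T u0) ≤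
      C * (ENNReal.ofReal ((1 + R) ^ ((n : ℝ) - 1)) *
        (ENNReal.ofReal ((6 * ε) ^ k) * μ (polarAt T z1))) :=
    s1.trans (s2.trans (s3.trans (s4.trans (by gcongr; exact s5.trans (by gcongr)))))
  have e1 : ENNReal.ofReal ((6 * ε) ^ k) = ENNReal.ofReal (ε ^ k) * ENNReal.ofReal (6 ^ k) := by
    rw [← ENNReal.ofReal_mul (by positivity), mul_pow, mul_comm]
  rw [e1] at s7
  have p1 : ENNReal.ofReal (ε ^ k) ≠ 0 := by
    rw [Ne, ENNReal.ofReal_eq_zero, not_le]; positivity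
  refine (ENNReal.mul_le_mul_iff_right p1 ENNReal.ofReal_ne_top).1 (s7.trans (le_of_eq ?_))
  ring

theorem core (hn : 2 ≤ n) {p : ℝ} (hp : p < 1) {τ1 τ2 : ℝ}
    (hτ1 : 0 < τ1) (hτ12 : τ1 < τ2) {f : EuclideanSpace ℝ (Fin n) → ℝ}
    (hf : ∀ u ∈ unitSphere n, τ1 < f u ∧ f u < τ2)
    (hK : IsConvexBody0 K) (hsol : IsLpSolution p f K)
    (hX0 : μH[(n : ℝ) - 1] {x ∈ frontier K | normalCone K x ⊆ normalCone K 0} = 0)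
    (he : ‖e‖ = 1) {x : EuclideanSpace ℝ (Fin n)} (hx : x ∈ K) {r R0 : ℝ} (hr : 0 < r)
    (hR0 : 0 ≤ R0) (hg : ∀ w : Fe e, r * ‖w‖ - R0 ≤ vfun K e x w)
    {a u0 u2 z1 : Fe e} (hz : u0 - z1 = z1 - u2) (ha : ⟪a, u0 - u2⟫ = 2)
    (hv0 : vfun K e x u0 = 0) (hv2 : vfun K e x u2 = 0)
    (hmax : ∀ w, vfun K e x w = 0 → ⟪a, w⟫ ≤ ⟪a, u0⟫)
    (hdens : suppFn K (e + z1) = 0 ∨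
      ∀ w, vfun K e x w = 0 → 0 ≤ ⟪a, w - u2⟫ → 0 < suppFn K (e + w)) : False := by
  obtain ⟨hKc, hKconv, hKi, h0⟩ := id hK
  have hne : K.Nonempty := ⟨0, h0⟩
  have hvc := vfun_continuous (e := e) hKc hne x
  set ε1 : ℝ := r / (2 * (‖a‖ + 1)) with hε1def
  have hε1 : 0 < ε1 := by positivity
  have hε1a : ε1 * ‖a‖ ≤ r / 2 := by
    have h1 : ε1 * (‖a‖ + 1) = r / 2 := by rw [hε1def]; field_simp
    nlinarith
  have hbd : ∀ ε, 0 < ε → ε ≤ ε1 → ε * ‖a‖ ≤ r / 2 := fun ε _ h =>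
    (mul_le_mul_of_nonneg_right h (norm_nonneg _)).trans hε1a
  set R : ℝ := 2 * R0 / r + ‖u2‖ with hRdef
  have hR : 0 ≤ R := by positivity
  -- basic points
  have hz1 : z1 = (1/2 : ℝ) • u0 + (1/2 : ℝ) • u2 := by
    have : u0 + u2 = (2:ℝ) • z1 := by
      rw [two_smul, ← sub_eq_zero]
      have h := sub_eq_zero.2 hz
      rw [← h]; abel
    rw [← smul_add, this, smul_smul]; norm_num
  have hvz : vfun K e x z1 = 0 := by
    refine le_antisymm ?_ (vfun_nonneg hKc hx z1)
    have := vfun_convex (e := e) hKc hne x u0 u2 (a := 1/2) (b := 1/2) (by norm_num) (by norm_num)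
      (by norm_num)
    rw [← hz1, hv0, hv2] at this
    simpa using this
  have hlz : ⟪a, z1 - u2⟫ = 1 := by
    have : z1 - u2 = (1/2 : ℝ) • (u0 - u2) := by rw [hz1]; module
    rw [this, real_inner_smul_right, ha]; norm_num
  have hlz' : ⟪a, u0 - z1⟫ = 1 := by rw [hz, hlz]
  have hu0T : ∀ ε, 0 < ε → u0 ∈ Tset K e x a u2 ε := fun ε h => by
    change vfun K e x u0 ≤ ε * ⟪a, u0 - u2⟫
    rw [hv0, ha]; positivity
  have hu2T : ∀ ε, 0 < ε → u2 ∈ Tset K e x a u2 ε := fun ε h => by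
    change vfun K e x u2 ≤ ε * ⟪a, u2 - u2⟫
    rw [hv2]; simp
  have hz1i : ∀ ε, 0 < ε → z1 ∈ interior (Tset K e x a u2 ε) := fun ε h => by
    have ho : IsOpen {w : Fe e | vfun K e x w < ε * ⟪a, w - u2⟫} := isOpen_lt hvc (by fun_prop)
    have hsub : {w : Fe e | vfun K e x w < ε * ⟪a, w - u2⟫} ⊆ Tset K e x a u2 ε :=
      fun w hw => le_of_lt (show vfun K e x w < ε * ⟪a, w - u2⟫ from hw)
    apply interior_maximal hsub ho
    change vfun K e x z1 < ε * ⟪a, z1 - u2⟫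
    rw [hvz, hlz]; linarith
  -- density comparison
  have hC0 : ∃ C0 ε2 : ℝ, 0 ≤ C0 ∧ 0 < ε2 ∧ ε2 ≤ ε1 ∧ ∀ w ∈ Tset K e x a u2 ε2,
      suppFn K (e + z1) ≤ C0 * suppFn K (e + w) := by
    rcases hdens with hd | hd
    · exact ⟨0, ε1, le_rfl, hε1, le_rfl, fun w _ => by rw [hd, zero_mul]⟩
    · have hsc : Continuous fun w : Fe e => suppFn K (e + w) :=
        (supp_continuous hKc hne).comp (by fun_prop)
      have hUo : IsOpen {w : Fe e | 0 < suppFn K (e + w)} := isOpen_lt continuous_const hsc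
      obtain ⟨ε2, h1, h2, h3⟩ := Tset_shrink hKc hne hx hr hg hε1 hε1a hUo hd
      have hcp : IsCompact (Tset K e x a u2 ε2) := Tset_compact hKc hne hr hg h1.le (hbd _ h1 h2)
      obtain ⟨w0, hw0, hmin⟩ := hcp.exists_isMinOn ⟨u2, hu2T _ h1⟩ hsc.continuousOn
      have hm : 0 < suppFn K (e + w0) := h3 _ h1 le_rfl hw0
      have hz0 := supp_nonneg hKc h0 (e + (z1 : EuclideanSpace ℝ (Fin n)))
      refine ⟨suppFn K (e + z1) / suppFn K (e + w0), ε2, by positivity, h1, h2, fun w hw => ?_⟩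
      have h4 : suppFn K (e + w0) ≤ suppFn K (e + w) := hmin hw
      rw [div_mul_eq_mul_div, le_div_iff₀ hm]
      gcongr
  obtain ⟨C0, ε2, hC0, hε2, hε21, hcmp⟩ := hC0
  have hz1R : ‖z1‖ ≤ R := Tset_growth hr hg hε1.le hε1a (interior_subset (hz1i _ hε1))
  obtain ⟨C, hC, hdbl⟩ := doubling hn hp hτ1 hτ12 hf hK hsol he hR hz1R hC0
  -- the measure
  have hfr := finrank_Fe hn he
  set μ : Measure (Fe e) := μH[(n : ℝ) - 1] with hμ
  have hHaar : μ.IsAddHaarMeasure := by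
    rw [hμ, ← hfr]
    exact MeasureTheory.isAddHaarMeasure_hausdorffMeasure
  set k := Module.finrank ℝ (Fe e) with hk
  set M : ℝ≥0∞ := C * ENNReal.ofReal ((1 + R) ^ ((n : ℝ) - 1)) * ENNReal.ofReal (6 ^ k) with hM
  have hMt : M ≠ ⊤ := ENNReal.mul_ne_top (ENNReal.mul_ne_top hC ENNReal.ofReal_ne_top)
    ENNReal.ofReal_ne_top
  set q : ℝ≥0∞ := ENNReal.ofReal ((1/4 : ℝ) ^ k) with hq
  have hq0 : q ≠ 0 := by
    rw [hq, Ne, ENNReal.ofReal_eq_zero, not_le]; positivity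
  obtain ⟨N, hN⟩ := ENNReal.exists_nat_gt (ENNReal.div_lt_top hMt hq0).ne
  have hNq : M < N * q := by
    rwa [ENNReal.div_lt_iff (Or.inl hq0) (Or.inl ENNReal.ofReal_ne_top)] at hN
  set δ : ℝ := 1 / (4 * ((N : ℝ) + 1)) with hδ
  have hδ0 : 0 < δ := by positivity
  have hNδ : 2 * N * δ < 1 := by
    rw [hδ, mul_one_div, div_lt_one (by positivity)]
    have : (0:ℝ) ≤ N := Nat.cast_nonneg N
    linarith
  have hδ1 : δ ≤ 1 := by
    rw [hδ, div_le_one (by positivity)]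
    have : (0:ℝ) ≤ N := Nat.cast_nonneg N
    linarith
  have hUo : IsOpen {w : Fe e | ⟪a, w⟫ < ⟪a, u0⟫ + δ} := isOpen_lt (by fun_prop) (by fun_prop)
  obtain ⟨ε3, hε3, hε31, hε3U⟩ := Tset_shrink (u2 := u2) hKc hne hx hr hg hε1 hε1a hUo
    (fun w hw _ => lt_of_le_of_lt (hmax w hw) (by linarith))
  set ε := min ε2 ε3 with hεdef
  have hε : 0 < ε := lt_min hε2 hε3
  have hε' : ε ≤ ε1 := (min_le_left _ _).trans hε21
  have hTU := hε3U ε hε (min_le_right _ _)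
  have hTR : ∀ w ∈ Tset K e x a u2 ε, ‖w‖ ≤ R := fun w hw =>
    Tset_growth hr hg hε.le (hbd _ hε hε') hw
  have hTd : ∀ w ∈ Tset K e x a u2 ε, ⟪a, w⟫ ≤ ⟪a, u0⟫ + δ := fun w hw => le_of_lt (hTU hw)
  have hTl : ∀ w ∈ Tset K e x a u2 ε, ⟪a, w - u2⟫ ≤ 3 := fun w hw => by
    have := hTd w hw
    rw [inner_sub_right] at ha ⊢
    linarith
  have hchain := core_chain hn hKc hKconv h0 he hX0 hx hε
    (Tset_compact hKc hne hr hg hε.le (hbd _ hε hε')) hv0 ha hR hTR hTl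
    (interior_subset (hz1i _ hε))
    (fun A hA hAT => hdbl A hA (fun w hw => hTR w (hAT hw))
      (fun w hw => hcmp w (Tset_mono hKc hx a u2 hε (min_le_left _ _) (hAT hw)))) μ hμ
  have hblow := polar_blowup μ (Tset K e x a u2 ε) u0 u2 z1 a hz (hu0T _ hε) (hu2T _ hε) hlz' N
    hδ0 hNδ hTd
  have hpos := polarAt_meas_pos μ (Tset K e x a u2 ε) z1 (R := R + R) (fun w hw =>
    (norm_sub_le _ _).trans (add_le_add (hTR w hw) hz1R))
  have hfin := polarAt_meas_lt_top μ (Tset K e x a u2 ε) z1 (hz1i _ hε)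
  have hle := hblow.trans hchain
  rw [← mul_assoc] at hle
  exact absurd ((ENNReal.mul_le_mul_iff_left hpos.ne' hfin.ne).1 hle) (not_le.2 hNq)

end core2

section final
variable {n : ℕ} {K : Set (EuclideanSpace ℝ (Fin n))} {e : EuclideanSpace ℝ (Fin n)}

lemma vfun_zero_iff (hK : IsCompact K) {x : EuclideanSpace ℝ (Fin n)} (hx : x ∈ K) (w : Fe e) :
    vfun K e x w = 0 ↔ e + (w : EuclideanSpace ℝ (Fin n)) ∈ normalCone K x := by
  constructor
  · intro h y hy
    have := le_supp hK (e + w) hy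
    rw [vfun] at h
    linarith
  · intro h
    refine le_antisymm ?_ (vfun_nonneg hK hx w)
    obtain ⟨y, hy, hy'⟩ := supp_attain hK ⟨x, hx⟩ (e + (w : EuclideanSpace ℝ (Fin n)))
    have := h y hy
    rw [vfun]
    linarith

lemma normalCone_exists (hc : Convex ℝ K) (hi : (interior K).Nonempty)
    {x : EuclideanSpace ℝ (Fin n)} (hx : x ∈ frontier K) :
    ∃ u ∈ normalCone K x, u ≠ 0 := by
  obtain ⟨g, hg⟩ := geometric_hahn_banach_open_point hc.interior isOpen_interior hx.2
  set u := (InnerProductSpace.toDual ℝ (EuclideanSpace ℝ (Fin n))).symm g with hu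
  have hug : ∀ y, ⟪u, y⟫ = g y := fun y => InnerProductSpace.toDual_symm_apply
  refine ⟨u, ?_, ?_⟩
  · intro y hy
    rw [hug, hug]
    have h1 : y ∈ closure (interior K) := by
      rw [hc.closure_interior_eq_closure_of_nonempty_interior hi]
      exact subset_closure hy
    have h2 : closure (interior K) ⊆ {y | g y ≤ g x} :=
      closure_minimal (fun z hz => (hg z hz).le) (isClosed_le g.continuous continuous_const)
    exact h2 h1
  · intro h
    obtain ⟨y, hy⟩ := hi
    have h1 := hg y hy
    rw [← hug, ← hug, h, inner_zero_left, inner_zero_left] at h1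
    exact lt_irrefl _ h1

theorem main_smooth (hn : 2 ≤ n) {p : ℝ} (hp : p < 1) {τ1 τ2 : ℝ}
    (hτ1 : 0 < τ1) (hτ12 : τ1 < τ2) {f : EuclideanSpace ℝ (Fin n) → ℝ}
    (hf : ∀ u ∈ unitSphere n, τ1 < f u ∧ f u < τ2)
    (hK : IsConvexBody0 K) (hsol : IsLpSolution p f K)
    (hX0 : μH[(n : ℝ) - 1] {x ∈ frontier K | normalCone K x ⊆ normalCone K 0} = 0) :
    IsSmoothBody K := by
  intro x hxf
  obtain ⟨hKc, hKconv, hKi, h0⟩ := id hK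
  have hne : K.Nonempty := ⟨0, h0⟩
  have hx : x ∈ K := hKc.isClosed.frontier_subset hxf
  obtain ⟨un, hunN, hun0⟩ := normalCone_exists hKconv hKi hxf
  obtain ⟨y0, hy0⟩ := hKi
  obtain ⟨r0, hr0, hball⟩ := Metric.isOpen_iff.1 isOpen_interior y0 hy0
  set r := r0 / 2 with hrdef
  have hr : 0 < r := by positivity
  have hxy : x ≠ y0 := by
    rintro rfl; exact hxf.2 hy0
  set L := ‖x - y0‖ with hL
  have hL0 : 0 < L := norm_pos_iff.2 (sub_ne_zero.2 hxy)
  set e : EuclideanSpace ℝ (Fin n) := L⁻¹ • (x - y0) with he_def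
  have he : ‖e‖ = 1 := by
    rw [he_def, norm_smul, norm_inv, Real.norm_of_nonneg hL0.le, ← hL, inv_mul_cancel₀ hL0.ne']
  have hLe : x - y0 = L • e := by rw [he_def, smul_smul, mul_inv_cancel₀ hL0.ne', one_smul]
  clear_value e
  -- the support function is at least that of the ball
  have hpt : ∀ u : EuclideanSpace ℝ (Fin n), u ≠ 0 →
      ∃ y ∈ K, ⟪u, y⟫ = ⟪u, y0⟫ + r * ‖u‖ := by
    intro u hu
    have hu0 : 0 < ‖u‖ := norm_pos_iff.2 hu
    refine ⟨y0 + (r / ‖u‖) • u, ?_, ?_⟩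
    · apply interior_subset
      apply hball
      rw [mem_ball_iff_norm, add_sub_cancel_left, norm_smul, Real.norm_of_nonneg (by positivity),
        div_mul_cancel₀ _ hu0.ne']
      rw [hrdef]; linarith
    · rw [inner_add_right, real_inner_smul_right, real_inner_self_eq_norm_sq]
      field_simp
  have hg : ∀ w : Fe e, r * ‖w‖ - (r + L) ≤ vfun K e x w := by
    intro w
    have hw1 := norm_slice_ge he w
    have hne0 : e + (w : EuclideanSpace ℝ (Fin n)) ≠ 0 := by
      intro h; rw [h, norm_zero] at hw1; linarith
    obtain ⟨y, hy, hy'⟩ := hpt _ hne0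
    have h1 := le_supp hKc (e + w) hy
    have h2 : ⟪e + (w : EuclideanSpace ℝ (Fin n)), x⟫ - ⟪e + (w : EuclideanSpace ℝ (Fin n)), y0⟫ = L := by
      rw [← inner_sub_right, hLe, real_inner_smul_right, real_inner_comm, inner_e_slice he, mul_one]
    have h3 : ‖w‖ - 1 ≤ ‖e + (w : EuclideanSpace ℝ (Fin n))‖ := by
      have := norm_sub_le (e + (w : EuclideanSpace ℝ (Fin n))) e
      rw [add_sub_cancel_left, he, Submodule.norm_coe] at this
      linarith
    have h4 : r * (‖w‖ - 1) ≤ r * ‖e + (w : EuclideanSpace ℝ (Fin n))‖ := by gcongr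
    rw [vfun]
    linarith
  have hvc := vfun_continuous (e := e) hKc hne x
  -- normals are multiples of slice normals
  have hslice : ∀ u ∈ normalCone K x, u ≠ 0 → ∃ (t : ℝ) (w : Fe e), vfun K e x w = 0 ∧
      u = t • (e + (w : EuclideanSpace ℝ (Fin n))) := by
    intro u hu hu0
    obtain ⟨y, hy, hy'⟩ := hpt u hu0
    have h1 := hu y hy
    have h2 : ⟪u, x⟫ - ⟪u, y0⟫ = L * ⟪e, u⟫ := by
      rw [← inner_sub_right, hLe, real_inner_smul_right, real_inner_comm]
    have h3 : 0 < r * ‖u‖ := mul_pos hr (norm_pos_iff.2 hu0)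
    have h4 : 0 < L * ⟪e, u⟫ := by linarith
    have ht : 0 < ⟪e, u⟫ := pos_of_mul_pos_right h4 hL0.le
    have h5 : u = ⟪e, u⟫ • (e + ((⟪e, u⟫⁻¹ • Pe e u : Fe e) : EuclideanSpace ℝ (Fin n))) := by
      rw [smul_add, Submodule.coe_smul, smul_smul, mul_inv_cancel₀ ht.ne', one_smul]
      exact decomp he u
    refine ⟨⟪e, u⟫, ⟪e, u⟫⁻¹ • Pe e u, ?_, h5⟩
    rw [vfun_zero_iff hKc hx]
    have h6 : e + ((⟪e, u⟫⁻¹ • Pe e u : Fe e) : EuclideanSpace ℝ (Fin n)) = ⟪e, u⟫⁻¹ • u := by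
      rw [eq_inv_smul_iff₀ ht.ne']
      exact h5.symm
    rw [h6]
    intro y hy
    rw [real_inner_smul_left, real_inner_smul_left]
    exact mul_le_mul_of_nonneg_left (hu y hy) (inv_pos.2 ht).le
  obtain ⟨t0, b0, hb0, -⟩ := hslice un hunN hun0
  by_cases huniq : ∀ w, vfun K e x w = 0 → w = b0
  · -- smooth
    have hspan : Submodule.span ℝ (normalCone K x) =
        Submodule.span ℝ {e + (b0 : EuclideanSpace ℝ (Fin n))} := by
      apply le_antisymm
      · rw [Submodule.span_le]
        intro u hu
        by_cases hu0 : u = 0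
        · rw [hu0]; exact Submodule.zero_mem _
        obtain ⟨t, w, hw, rfl⟩ := hslice u hu hu0
        rw [huniq w hw]
        exact Submodule.smul_mem _ _ (Submodule.mem_span_singleton_self _)
      · rw [Submodule.span_singleton_le_iff_mem]
        exact Submodule.subset_span ((vfun_zero_iff hKc hx b0).1 hb0)
    rw [IsSmoothPt, hspan]
    apply finrank_span_singleton
    intro h
    have := norm_slice_ge he b0
    rw [h, norm_zero] at this
    linarith
  exfalso
  push Not at huniq
  obtain ⟨b1, hb1, hb10⟩ := huniq
  set B : Set (Fe e) := {w | vfun K e x w = 0} with hB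
  have hBc : IsCompact B := by
    refine Metric.isCompact_of_isClosed_isBounded (isClosed_eq hvc continuous_const) ?_
    refine (Metric.isBounded_closedBall (x := (0 : Fe e)) (r := (r + L) / r)).subset ?_
    intro w hw
    have hw' : vfun K e x w = 0 := hw
    have := hg w
    rw [mem_closedBall_zero_iff, le_div_iff₀ hr]
    linarith
  have hmid : ∀ w w', vfun K e x w = 0 → vfun K e x w' = 0 →
      vfun K e x ((1/2 : ℝ) • w + (1/2 : ℝ) • w') = 0 := by
    intro w w' h1 h2
    refine le_antisymm ?_ (vfun_nonneg hKc hx _)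
    have := vfun_convex (e := e) hKc hne x w w' (a := 1/2) (b := 1/2) (by norm_num) (by norm_num)
      (by norm_num)
    rw [h1, h2] at this
    simpa using this
  have hsupp : ∀ w, vfun K e x w = 0 → suppFn K (e + w) = ⟪e, x⟫ + ⟪Pe e x, w⟫ := by
    intro w hw
    rw [vfun_eq] at hw
    linarith
  have key : ∀ c u0 u2 : Fe e, vfun K e x u0 = 0 → vfun K e x u2 = 0 → 0 < ⟪c, u0 - u2⟫ →
      (∀ w, vfun K e x w = 0 → ⟪c, w⟫ ≤ ⟪c, u0⟫) →
      (suppFn K (e + (((1/2 : ℝ) • u0 + (1/2 : ℝ) • u2 : Fe e) : EuclideanSpace ℝ (Fin n))) = 0 ∨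
      ∀ w, vfun K e x w = 0 → ⟪c, u2⟫ ≤ ⟪c, w⟫ → 0 < suppFn K (e + w)) → False := by
    intro c u0 u2 hu0 hu2 hgap hmax hdens
    have hs : 0 < 2 / ⟪c, u0 - u2⟫ := by positivity
    refine core hn hp hτ1 hτ12 hf hK hsol hX0 he hx hr (by positivity : 0 ≤ r + L) hg
      (a := (2 / ⟪c, u0 - u2⟫) • c) (u0 := u0) (u2 := u2)
      (z1 := (1/2 : ℝ) • u0 + (1/2 : ℝ) • u2) (by module) ?_ hu0 hu2 ?_ ?_
    · rw [real_inner_smul_left, div_mul_cancel₀ _ hgap.ne']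
    · intro w hw
      rw [real_inner_smul_left, real_inner_smul_left]
      exact mul_le_mul_of_nonneg_left (hmax w hw) hs.le
    · refine hdens.imp id fun h w hw hl => h w hw ?_
      rw [real_inner_smul_left] at hl
      have := nonneg_of_mul_nonneg_right hl hs
      rw [inner_sub_right] at this
      linarith
  have hext : ∀ c : Fe e, ∃ M m, vfun K e x M = 0 ∧ vfun K e x m = 0 ∧
      (∀ w, vfun K e x w = 0 → ⟪c, w⟫ ≤ ⟪c, M⟫) ∧ (∀ w, vfun K e x w = 0 → ⟪c, m⟫ ≤ ⟪c, w⟫) := by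
    intro c
    have hcc : ContinuousOn (fun w : Fe e => ⟪c, w⟫) B := by fun_prop
    obtain ⟨M, hM, hM'⟩ := hBc.exists_isMaxOn ⟨b0, hb0⟩ hcc
    obtain ⟨m, hm, hm'⟩ := hBc.exists_isMinOn ⟨b0, hb0⟩ hcc
    exact ⟨M, m, hM, hm, fun w hw => hM' hw, fun w hw => hm' hw⟩
  obtain ⟨M, m, hM, hm, hMax, hMin⟩ := hext (Pe e x)
  rcases (hMax m hm).lt_or_eq with hlt | heq
  · refine key (Pe e x) M ((1/2 : ℝ) • M + (1/2 : ℝ) • m) hM (hmid _ _ hM hm) ?_ hMax (Or.inr ?_)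
    · rw [inner_sub_right, inner_add_right, real_inner_smul_right, real_inner_smul_right]
      linarith
    · intro w hw hle
      rw [inner_add_right, real_inner_smul_right, real_inner_smul_right] at hle
      have h1 := hsupp m hm
      have h2 := supp_nonneg hKc h0 (e + (m : EuclideanSpace ℝ (Fin n)))
      rw [hsupp w hw]
      linarith
  · have hconst : ∀ w, vfun K e x w = 0 → suppFn K (e + w) = suppFn K (e + m) := by
      intro w hw
      rw [hsupp w hw, hsupp m hm]
      have h1 := hMax w hw
      have h2 := hMin w hw
      linarith
    obtain ⟨M', m', hM', hm', hMax', hMin'⟩ := hext (b1 - b0)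
    have hgap : 0 < ⟪b1 - b0, M' - m'⟫ := by
      have h1 := hMax' b1 hb1
      have h2 := hMin' b0 hb0
      have h3 : 0 < ⟪b1 - b0, b1 - b0⟫ := real_inner_self_pos.2 (sub_ne_zero.2 hb10)
      rw [inner_sub_right] at h3 ⊢
      linarith
    refine key (b1 - b0) M' m' hM' hm' hgap hMax' ?_
    rw [hconst _ (hmid _ _ hM' hm')]
    rcases (supp_nonneg hKc h0 (e + (m : EuclideanSpace ℝ (Fin n)))).lt_or_eq with h | h
    · exact Or.inr fun w hw _ => by rw [hconst w hw]; exact h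
    · exact Or.inl h.symm

end final

/-- **Theorem 1.3 (ii).** If `H^{n-1}(X₀) = 0` for
`X₀ = {x ∈ ∂K : N(K,x) ⊆ N(K,o)}`, then `K` is smooth. -/
theorem stmt4 {n : ℕ} (hn : 2 ≤ n) {p : ℝ} (hp : p < 1) {τ1 τ2 : ℝ}
    (hτ1 : 0 < τ1) (hτ12 : τ1 < τ2) {f : EuclideanSpace ℝ (Fin n) → ℝ}
    (hf : ∀ u ∈ unitSphere n, τ1 < f u ∧ f u < τ2)
    {K : Set (EuclideanSpace ℝ (Fin n))} (hK : IsConvexBody0 K)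
    (hsol : IsLpSolution p f K)
    (hX0 : μH[(n : ℝ) - 1] {x ∈ frontier K | normalCone K x ⊆ normalCone K 0} = 0) :
    IsSmoothBody K := by
  exact main_smooth hn hp hτ1 hτ12 hf hK hsol hX0
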